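/- Let n ≥ 1, let V ⊆ ℝ^n be an n-dimensional simplex all of whose vertices lie in ℚ^n, let f₁,…,f_k : ℝ^n → ℝ be affine (degree ≤ 1) polynomials with rational coefficients, each positive on the interior of V, and suppose all f₁,…,f_k vanish at one common vertex p of V. Let m be a positive integer with m·k ≥ n, let E : ℂ × ℂ^n → ℂ be analytic on an open set containing ℂ × V, and let (𝒱_i)_{i ∈ ℕ} be a family of ℚ-linear subspaces of ℂ. Assume that for every multi-index α ∈ ℕ^n, the coefficient of (x−p)^α in the Taylor expansion at p of the analytic function x ↦ E(−m, x) lies in 𝒱_{|α|} (where |α| = α₁+⋯+α_n). Then there exists F : ℂ → ℂ, meromorphic on all of ℂ, with F(s) = ∫_V (f₁(x)⋯f_k(x))^s · E(s,x) dx for every s with Re(s) > 0, such that the limit lim_{s→−m} (s+m)^n · F(s) exists and lies in 𝒱_{mk−n}. -/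

import Mathlib

open Complex MeasureTheory Filter
open scoped Topology

/-- A dominated parametric integral of functions which are holomorphic in the parameter is
holomorphic in the parameter. -/
theorem differentiableAt_integral_of_dominated {Z T : Type*} [NormedAddCommGroup Z]
    [NormedSpace ℂ Z] [FiniteDimensional ℂ Z] [MeasurableSpace T] {μ : Measure T}
    {k : Z → T → ℂ} {z₀ : Z} {ρ : ℝ} (hρ : 0 < ρ) {g : T → ℝ} (hg : Integrable g μ)
    (hmeas : ∀ z ∈ Metric.ball z₀ ρ, AEStronglyMeasurable (k z) μ)
    (hdiff : ∀ᵐ t ∂μ, DifferentiableOn ℂ (fun z => k z t) (Metric.ball z₀ ρ))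
    (hbound : ∀ᵐ t ∂μ, ∀ z ∈ Metric.ball z₀ ρ, ‖k z t‖ ≤ g t) :
    DifferentiableAt ℂ (fun z => ∫ t, k z t ∂μ) z₀ := by
  have hz₀ : z₀ ∈ Metric.ball z₀ ρ := Metric.mem_ball_self hρ
  have hda : ∀ᵐ t ∂μ, DifferentiableAt ℂ (fun z => k z t) z₀ := by
    filter_upwards [hdiff] with t ht
    exact ht.differentiableAt (Metric.ball_mem_nhds _ hρ)
  have hF' : AEStronglyMeasurable (fun t => fderiv ℂ (fun z => k z t) z₀) μ := by
    let b := Module.finBasis ℂ Z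
    have hrep : (fun t => fderiv ℂ (fun z => k z t) z₀) = fun t =>
        ∑ i, (fderiv ℂ (fun z => k z t) z₀ (b i)) • (b.coord i).toContinuousLinearMap := by
      funext t
      ext v
      conv_lhs => rw [← b.sum_repr v, map_sum]
      simp [mul_comm]
    rw [hrep]
    refine Finset.aestronglyMeasurable_fun_sum _ fun i _ => ?_
    refine AEStronglyMeasurable.smul_const ?_ _
    obtain ⟨u, hu0, hu1⟩ : ∃ u : ℕ → ℂ, (∀ n, u n ≠ 0 ∧ z₀ + u n • b i ∈ Metric.ball z₀ ρ) ∧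
        Tendsto u atTop (𝓝 0) := by
      have hcont : Tendsto (fun w : ℂ => z₀ + w • b i) (𝓝[≠] 0) (𝓝 z₀) := by
        have : Continuous (fun w : ℂ => z₀ + w • b i) := by fun_prop
        simpa using (this.tendsto 0).mono_left nhdsWithin_le_nhds
      have hev : ∀ᶠ w : ℂ in 𝓝[≠] 0, w ≠ 0 ∧ z₀ + w • b i ∈ Metric.ball z₀ ρ :=
        (eventually_mem_nhdsWithin.mono fun w hw => hw).and
          (hcont.eventually (Metric.ball_mem_nhds _ hρ))
      obtain ⟨u, hu⟩ := exists_seq_tendsto (𝓝[≠] (0 : ℂ))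
      obtain ⟨N, hN⟩ := eventually_atTop.1 (hu.eventually hev)
      refine ⟨fun n => u (n + N), fun n => hN _ (Nat.le_add_left _ _), ?_⟩
      exact (tendsto_add_atTop_iff_nat N).2 (hu.mono_right nhdsWithin_le_nhds)
    refine aestronglyMeasurable_of_tendsto_ae (u := atTop)
      (f := fun n t => (u n)⁻¹ • (k (z₀ + u n • b i) t - k z₀ t)) ?_ ?_
    · intro n
      exact ((hmeas _ (hu0 n).2).sub (hmeas _ hz₀)).const_smul (u n)⁻¹
    · filter_upwards [hda] with t ht
      have h := ht.hasFDerivAt.hasLineDerivAt (b i)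
      have h2 := hasDerivAt_iff_tendsto_slope_zero.1 h
      have h3 := h2.comp (tendsto_nhdsWithin_iff.2 ⟨hu1, Eventually.of_forall fun n => (hu0 n).1⟩)
      refine h3.congr fun n => ?_
      simp
  refine (hasFDerivAt_integral_of_dominated_loc_of_lip' (bound := fun t => 2 * g t / ρ)
    (F' := fun t => fderiv ℂ (fun z => k z t) z₀) (Metric.ball_mem_nhds z₀ hρ) hmeas
    ?_ hF' ?_ ?_ ?_).2.differentiableAt
  · refine Integrable.mono' hg (hmeas _ hz₀) ?_
    filter_upwards [hbound] with t ht using ht _ hz₀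
  · filter_upwards [hdiff, hbound] with t hd hb z hz
    have := Complex.dist_le_div_mul_dist_of_mapsTo_ball (R₂ := 2 * g t) hd ?_ hz
    · simpa [dist_eq_norm] using this
    · intro w hw
      rw [Metric.mem_closedBall, dist_eq_norm]
      calc ‖k w t - k z₀ t‖ ≤ ‖k w t‖ + ‖k z₀ t‖ := norm_sub_le _ _
        _ ≤ g t + g t := add_le_add (hb w hw) (hb z₀ hz₀)
        _ = 2 * g t := by ring
  · exact (hg.const_mul 2).div_const ρ
  · filter_upwards [hda] with t ht using ht.hasFDerivAt

/-- On an open set, the partial derivative in the last variable of a holomorphic function of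
several variables is holomorphic. -/
theorem differentiableOn_deriv_snd {Z : Type*} [NormedAddCommGroup Z]
    [NormedSpace ℂ Z] [FiniteDimensional ℂ Z] {h : Z × ℂ → ℂ} {D : Set (Z × ℂ)} (hD : IsOpen D)
    (hh : DifferentiableOn ℂ h D) :
    DifferentiableOn ℂ (fun y : Z × ℂ => deriv (fun t => h (y.1, t)) y.2) D := by
  rintro ⟨z₀, t₀⟩ hy
  refine DifferentiableAt.differentiableWithinAt ?_
  obtain ⟨R, hR, hRD⟩ := Metric.nhds_basis_closedBall.mem_iff.1 (hD.mem_nhds hy)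
  have hball : ∀ z t, dist z z₀ ≤ R → dist t t₀ ≤ R → (z, t) ∈ D := fun z t hz ht =>
    hRD (by rw [Metric.mem_closedBall, Prod.dist_eq]; exact max_le hz ht)
  obtain ⟨C, hC⟩ : ∃ C, ∀ y ∈ Metric.closedBall (z₀, t₀) R, ‖h y‖ ≤ C := by
    have : ProperSpace (Z × ℂ) := FiniteDimensional.proper ℂ _
    exact (isCompact_closedBall _ _).exists_bound_of_continuousOn (hh.continuousOn.mono hRD)
  have hC0 : 0 ≤ C := (norm_nonneg _).trans (hC _ (Metric.mem_closedBall_self hR.le))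
  set γ : ℝ → ℂ := circleMap t₀ R
  have hγ : ∀ θ, dist (γ θ) t₀ = R := fun θ =>
    circleMap_mem_sphere t₀ hR.le θ
  let k : Z × ℂ → ℝ → ℂ := fun y θ => deriv γ θ * ((γ θ - y.2) ^ 2)⁻¹ * h (y.1, γ θ)
  have hlow : ∀ y ∈ Metric.ball (z₀, t₀) (R / 2), ∀ θ, R / 2 ≤ ‖γ θ - y.2‖ := by
    intro y hy θ
    have h1 : dist y.2 t₀ < R / 2 :=
      lt_of_le_of_lt (le_max_right _ _) (by simpa [Prod.dist_eq] using hy)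
    have h2 := dist_triangle (γ θ) y.2 t₀
    rw [hγ, dist_eq_norm] at h2
    linarith
  have hz : ∀ y ∈ Metric.ball (z₀, t₀) (R / 2), dist y.1 z₀ < R / 2 := fun y hy =>
    lt_of_le_of_lt (le_max_left _ _) (by simpa [Prod.dist_eq] using hy)
  have hderiv : ∀ θ, ‖deriv γ θ‖ = R := fun θ => by
    simp [γ, abs_of_pos hR]
  have key : DifferentiableAt ℂ
      (fun y => ∫ θ in Set.Ioc 0 (2 * Real.pi), k y θ) (z₀, t₀) := by
    refine differentiableAt_integral_of_dominated (ρ := R / 2) (by positivity)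
      (g := fun _ => R * ((R / 2) ^ 2)⁻¹ * C) (integrableOn_const (by simp [ENNReal.mul_eq_top])) ?_ ?_ ?_
    · intro y hy
      refine Continuous.aestronglyMeasurable ?_
      have h1 : Continuous γ := continuous_circleMap _ _
      have h2 : Continuous (deriv γ) := by
        have : deriv γ = fun θ => circleMap 0 R θ * I := by
          funext θ; simp [γ]
        rw [this]; exact (continuous_circleMap _ _).mul continuous_const
      refine (h2.mul (Continuous.inv₀ (by fun_prop) fun θ => ?_)).mul ?_
      · have := hlow y hy θ
        have h3 : 0 < ‖γ θ - y.2‖ := by linarith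
        exact pow_ne_zero _ (norm_pos_iff.1 h3)
      · refine hh.continuousOn.comp_continuous (by fun_prop) fun θ => ?_
        exact hball _ _ (by linarith [hz y hy]) (hγ θ).le
    · refine Eventually.of_forall fun θ y hy => DifferentiableAt.differentiableWithinAt ?_
      have h0 : γ θ - y.2 ≠ 0 := by
        have := hlow y hy θ
        have h3 : 0 < ‖γ θ - y.2‖ := by linarith
        exact norm_pos_iff.1 h3
      have h1 : DifferentiableAt ℂ (fun y : Z × ℂ => h (y.1, γ θ)) y := by
        have : DifferentiableAt ℂ h (y.1, γ θ) := hh.differentiableAt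
          (hD.mem_nhds (hball _ _ (by linarith [hz y hy]) (hγ θ).le))
        exact this.comp y (by fun_prop : DifferentiableAt ℂ (fun y : Z × ℂ => (y.1, γ θ)) y)
      have h2 : DifferentiableAt ℂ (fun y : Z × ℂ => ((γ θ - y.2) ^ 2)⁻¹) y :=
        DifferentiableAt.inv (by fun_prop) (pow_ne_zero _ h0)
      exact (h2.const_mul _).mul h1
    · refine Eventually.of_forall fun θ y hy => ?_
      simp only [k, norm_mul, norm_inv, norm_pow, hderiv]
      gcongr
      · exact hlow y hy θ
      · exact hC _ (by
          rw [Metric.mem_closedBall, Prod.dist_eq]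
          exact max_le (by linarith [hz y hy]) (hγ θ).le)
  refine (key.const_mul ((2 * Real.pi * I : ℂ)⁻¹)).congr_of_eventuallyEq ?_
  filter_upwards [Metric.ball_mem_nhds (z₀, t₀) (show 0 < R / 2 by positivity)] with y hy
  have hy2 : dist y.2 t₀ < R / 2 :=
    lt_of_le_of_lt (le_max_right _ _) (by simpa [Prod.dist_eq] using hy)
  have := Complex.two_pi_I_inv_smul_circleIntegral_sub_sq_inv_smul_of_differentiable
    (U := {t | (y.1, t) ∈ D}) (f := fun t => h (y.1, t)) (c := t₀) (w₀ := y.2) (R := R)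
    (hD.preimage (by fun_prop)) (fun t ht => hball _ _ (by linarith [hz y hy]) ht) (by
      intro t ht
      have : DifferentiableAt ℂ h (y.1, t) := hh.differentiableAt (hD.mem_nhds ht)
      exact (this.comp t (by fun_prop : DifferentiableAt ℂ (fun t : ℂ => (y.1, t)) t)
        ).differentiableWithinAt)
    (by rw [Metric.mem_ball]; linarith)
  rw [← this, circleIntegral, intervalIntegral.integral_of_le (by positivity)]
  simp [k, γ, smul_eq_mul, mul_assoc]

theorem differentiableOn_iteratedDeriv_snd {Z : Type*} [NormedAddCommGroup Z]
    [NormedSpace ℂ Z] [FiniteDimensional ℂ Z] {h : Z × ℂ → ℂ} {D : Set (Z × ℂ)} (hD : IsOpen D)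
    (hh : DifferentiableOn ℂ h D) (i : ℕ) :
    DifferentiableOn ℂ (fun y : Z × ℂ => iteratedDeriv i (fun t => h (y.1, t)) y.2) D := by
  induction i with
  | zero => simpa using hh
  | succ i ih =>
    simp only [iteratedDeriv_succ]
    exact differentiableOn_deriv_snd hD ih

/-- The set of those `z` for which `{z} × [0, 1]` is contained in `D`. -/
def unitFiberCore {Z : Type*} (D : Set (Z × ℂ)) : Set Z :=
  {z | ∀ t ∈ Set.Icc (0 : ℝ) 1, (z, (t : ℂ)) ∈ D}

theorem isOpen_unitFiberCore {Z : Type*} [TopologicalSpace Z] {D : Set (Z × ℂ)} (hD : IsOpen D) :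
    IsOpen (unitFiberCore D) := by
  have hD' : IsOpen {y : Z × ℝ | (y.1, (y.2 : ℂ)) ∈ D} := hD.preimage (by fun_prop)
  rw [isOpen_iff_mem_nhds]
  intro z hz
  have := isCompact_Icc.eventually_forall_of_forall_eventually (x₀ := z)
    (K := Set.Icc (0 : ℝ) 1) (P := fun z t => (z, (t : ℂ)) ∈ D)
    fun t ht => hD'.mem_nhds (hz t ht)
  exact this

/-- The integral `∫₀¹ t ^ (α - 1) h(t) dt`, divided by `Γ(α)`, after `M` integrations by parts. -/
noncomputable def regMellin (h : ℂ → ℂ) (α : ℂ) (M : ℕ) : ℂ :=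
  ∑ i ∈ Finset.range M, (-1) ^ i * iteratedDeriv i h 1 * (Gamma (α + i + 1))⁻¹ +
    (-1) ^ M * (Gamma (α + M))⁻¹ * ∫ t in (0 : ℝ)..1, (t : ℂ) ^ (α + M - 1) * iteratedDeriv M h t

theorem integral_cpow_mul_by_parts {g g' : ℂ → ℂ} {β : ℂ} (hβ : 0 < β.re)
    (hg : ∀ t ∈ Set.Icc (0 : ℝ) 1, HasDerivAt g (g' t) t)
    (hg' : ContinuousOn (fun t : ℝ => g' t) (Set.Icc (0 : ℝ) 1)) :
    β * ∫ t in (0 : ℝ)..1, (t : ℂ) ^ (β - 1) * g t =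
      g 1 - ∫ t in (0 : ℝ)..1, (t : ℂ) ^ β * g' t := by
  have hβ0 : β ≠ 0 := by rintro rfl; simp at hβ
  have hgc : ContinuousOn (fun t : ℝ => g t) (Set.Icc (0 : ℝ) 1) := fun t ht =>
    ((hg t ht).continuousAt.comp (f := fun t : ℝ => (t : ℂ))
      continuous_ofReal.continuousAt).continuousWithinAt
  have hpow : Continuous (fun t : ℝ => (t : ℂ) ^ β) := continuous_ofReal_cpow_const hβ
  have hI1 : IntervalIntegrable (fun t : ℝ => (t : ℂ) ^ (β - 1) * g t) volume 0 1 := by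
    refine (intervalIntegral.intervalIntegrable_cpow' ?_).mul_continuousOn ?_
    · simpa using hβ
    · rwa [Set.uIcc_of_le zero_le_one]
  have hI2 : IntervalIntegrable (fun t : ℝ => (t : ℂ) ^ β * g' t) volume 0 1 := by
    refine ContinuousOn.intervalIntegrable ?_
    rw [Set.uIcc_of_le zero_le_one]
    exact hpow.continuousOn.mul hg'
  have := intervalIntegral.integral_eq_sub_of_hasDerivAt_of_le (a := 0) (b := 1)
    (f := fun t : ℝ => (t : ℂ) ^ β * g t)
    (f' := fun t : ℝ => β * ((t : ℂ) ^ (β - 1) * g t) + (t : ℂ) ^ β * g' t) zero_le_one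
    (hpow.continuousOn.mul hgc) (fun t ht => ?_) ((hI1.const_mul β).add hI2)
  · rw [intervalIntegral.integral_add (hI1.const_mul β) hI2,
      intervalIntegral.integral_const_mul] at this
    simp only [ofReal_one, one_cpow, one_mul, ofReal_zero, zero_cpow hβ0, zero_mul,
      sub_zero] at this
    linear_combination this
  · have h1 : HasDerivAt (fun t : ℝ => g t) (g' t) t :=
      (hg t ⟨ht.1.le, ht.2.le⟩).comp_ofReal
    have h2 : HasDerivAt (fun t : ℝ => (t : ℂ) ^ β) (β * (t : ℂ) ^ (β - 1)) t :=
      hasDerivAt_ofReal_cpow_const ht.1.ne' hβ0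
    simpa only [mul_assoc] using h2.fun_mul h1

section
variable {h : ℂ → ℂ} {D : Set ℂ}

theorem hasDerivAt_iteratedDeriv (hD : IsOpen D) (hh : DifferentiableOn ℂ h D) (i : ℕ) {t : ℂ}
    (ht : t ∈ D) : HasDerivAt (iteratedDeriv i h) (iteratedDeriv (i + 1) h t) t := by
  rw [iteratedDeriv_succ]
  have : AnalyticAt ℂ h t := (hh.analyticOnNhd hD) t ht
  exact (this.iterated_deriv i |>.congr (by rw [iteratedDeriv_eq_iterate])).differentiableAt.hasDerivAt

theorem continuousOn_iteratedDeriv (hD : IsOpen D) (hh : DifferentiableOn ℂ h D)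
    (h01 : ∀ t ∈ Set.Icc (0 : ℝ) 1, (t : ℂ) ∈ D) (i : ℕ) :
    ContinuousOn (fun t : ℝ => iteratedDeriv i h t) (Set.Icc (0 : ℝ) 1) := fun t ht =>
  ((hasDerivAt_iteratedDeriv hD hh i (h01 t ht)).continuousAt.comp (f := fun t : ℝ => (t : ℂ))
      continuous_ofReal.continuousAt).continuousWithinAt

theorem regMellin_succ (hD : IsOpen D) (hh : DifferentiableOn ℂ h D)
    (h01 : ∀ t ∈ Set.Icc (0 : ℝ) 1, (t : ℂ) ∈ D) {α : ℂ} {M : ℕ} (hα : 0 < (α + M).re) :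
    regMellin h α (M + 1) = regMellin h α M := by
  have := integral_cpow_mul_by_parts (g := iteratedDeriv M h) (g' := iteratedDeriv (M + 1) h) hα
    (fun t ht => hasDerivAt_iteratedDeriv hD hh M (h01 t ht))
    (continuousOn_iteratedDeriv hD hh h01 (M + 1))
  have hG := one_div_Gamma_eq_self_mul_one_div_Gamma_add_one (α + M)
  simp only [regMellin, Finset.sum_range_succ]
  rw [hG]
  push_cast
  rw [show α + (M + 1 : ℂ) - 1 = α + M by ring, show α + (M + 1 : ℂ) = α + M + 1 by ring]
  have e : ∀ a b : ℂ, (-1) ^ M * ((α + M) * a) * b = (-1) ^ M * a * ((α + M) * b) := by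
    intros; ring
  rw [e, this]
  ring

theorem regMellin_eq_of_le (hD : IsOpen D) (hh : DifferentiableOn ℂ h D)
    (h01 : ∀ t ∈ Set.Icc (0 : ℝ) 1, (t : ℂ) ∈ D) {α : ℂ} {M N : ℕ} (hα : 0 < (α + M).re)
    (hMN : M ≤ N) : regMellin h α N = regMellin h α M := by
  induction N, hMN using Nat.le_induction with
  | base => rfl
  | succ N hN ih =>
    rw [regMellin_succ hD hh h01, ih]
    have : (M : ℝ) ≤ N := by exact_mod_cast hN
    simp only [add_re, natCast_re] at hα ⊢
    linarith

theorem regMellin_neg_nat (hD : IsOpen D) (hh : DifferentiableOn ℂ h D)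
    (h01 : ∀ t ∈ Set.Icc (0 : ℝ) 1, (t : ℂ) ∈ D) (e : ℕ) :
    regMellin h (-e) (e + 1) = (-1) ^ e * iteratedDeriv e h 0 := by
  have hftc : ∫ t in (0 : ℝ)..1, iteratedDeriv (e + 1) h t =
      iteratedDeriv e h 1 - iteratedDeriv e h 0 := by
    have := intervalIntegral.integral_eq_sub_of_hasDerivAt (a := 0) (b := 1)
      (f := fun t : ℝ => iteratedDeriv e h t) (f' := fun t : ℝ => iteratedDeriv (e + 1) h t)
      (fun t ht => (hasDerivAt_iteratedDeriv hD hh e (h01 t (by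
        rwa [Set.uIcc_of_le zero_le_one] at ht))).comp_ofReal)
      (ContinuousOn.intervalIntegrable (by
        rw [Set.uIcc_of_le zero_le_one]; exact continuousOn_iteratedDeriv hD hh h01 (e + 1)))
    simpa using this
  simp only [regMellin, Finset.sum_range_succ]
  rw [Finset.sum_eq_zero]
  · push_cast
    simp only [neg_add_cancel, zero_add, Gamma_one, inv_one, mul_one, neg_add_cancel_left, sub_self,
      cpow_zero, one_mul]
    rw [hftc]
    ring
  · intro i hi
    have hi' : i < e := Finset.mem_range.1 hi
    obtain ⟨j, rfl⟩ : ∃ j, e = i + 1 + j := ⟨e - (i + 1), by omega⟩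
    have : (-((i + 1 + j : ℕ) : ℂ) + i + 1) = -(j : ℂ) := by push_cast; ring
    rw [this, Gamma_neg_nat_eq_zero]
    simp
end

theorem exists_mellin_continuation {Z : Type*} [NormedAddCommGroup Z] [NormedSpace ℂ Z]
    [FiniteDimensional ℂ Z] {α : Z → ℂ} (hα : Differentiable ℂ α) {h : Z × ℂ → ℂ}
    {D : Set (Z × ℂ)} (hD : IsOpen D) (hh : DifferentiableOn ℂ h D) :
    ∃ H : Z → ℂ, DifferentiableOn ℂ H (unitFiberCore D) ∧
      (∀ z ∈ unitFiberCore D, 0 < (α z).re →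
        ∫ t in (0 : ℝ)..1, (t : ℂ) ^ (α z - 1) * h (z, t) = Gamma (α z) * H z) ∧
      ∀ z ∈ unitFiberCore D, ∀ e : ℕ, α z = -e →
        H z = (-1) ^ e * iteratedDeriv e (fun t => h (z, t)) 0 := by
  have hDz : ∀ z, IsOpen {t : ℂ | (z, t) ∈ D} := fun z => hD.preimage (by fun_prop)
  have hhz : ∀ z, DifferentiableOn ℂ (fun t => h (z, t)) {t : ℂ | (z, t) ∈ D} := fun z t ht =>
    ((hh.differentiableAt (hD.mem_nhds ht)).comp t
      (by fun_prop : DifferentiableAt ℂ (fun t : ℂ => (z, t)) t)).differentiableWithinAt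
  have hN : ∀ z, ∃ N : ℕ, 0 < (α z + N).re := fun z => by
    obtain ⟨N, hN⟩ := exists_nat_gt (-(α z).re)
    exact ⟨N, by simp only [add_re, natCast_re]; linarith⟩
  choose N hN using hN
  have hNM : ∀ z ∈ unitFiberCore D, ∀ M : ℕ, 0 < (α z + M).re →
      regMellin (fun t => h (z, t)) (α z) (N z) = regMellin (fun t => h (z, t)) (α z) M := by
    intro z hz M hM
    rcases le_total M (N z) with hle | hle
    · exact regMellin_eq_of_le (hDz z) (hhz z) hz hM hle
    · exact (regMellin_eq_of_le (hDz z) (hhz z) hz (hN z) hle).symm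
  refine ⟨fun z => regMellin (fun t => h (z, t)) (α z) (N z), ?_, ?_, ?_⟩
  · intro z₀ hz₀
    refine DifferentiableAt.differentiableWithinAt ?_
    obtain ⟨M, hM⟩ := exists_nat_gt (1 - (α z₀).re)
    have hopen : ∀ᶠ z in 𝓝 z₀, z ∈ unitFiberCore D ∧ 1 < (α z + M).re := by
      refine Eventually.and ((isOpen_unitFiberCore hD).mem_nhds hz₀) ?_
      have hc : Continuous fun z => (α z + M).re :=
        continuous_re.comp (hα.continuous.add continuous_const)
      exact hc.continuousAt.eventually (lt_mem_nhds (by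
        simp only [add_re, natCast_re]; linarith))
    suffices hs : DifferentiableAt ℂ (fun z => regMellin (fun t => h (z, t)) (α z) M) z₀ by
      refine hs.congr_of_eventuallyEq ?_
      filter_upwards [hopen] with z hz
      exact hNM z hz.1 M (by linarith [hz.2])
    obtain ⟨R, hR, hRD⟩ := Metric.nhds_basis_closedBall.mem_iff.1 hopen
    have hiter := differentiableOn_iteratedDeriv_snd hD hh
    have hat : ∀ (i : ℕ) (t : ℂ) (z : Z), (z, t) ∈ D →
        DifferentiableAt ℂ (fun z => iteratedDeriv i (fun t => h (z, t)) t) z := by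
      intro i t z ht
      exact ((hiter i).differentiableAt (hD.mem_nhds ht)).comp z
        (by fun_prop : DifferentiableAt ℂ (fun z : Z => (z, t)) z)
    obtain ⟨C, hC⟩ : ∃ C, ∀ y ∈ Metric.closedBall z₀ R ×ˢ Set.Icc (0 : ℝ) 1,
        ‖iteratedDeriv M (fun t => h (y.1, t)) (y.2 : ℂ)‖ ≤ C := by
      have : ProperSpace Z := FiniteDimensional.proper ℂ _
      refine ((isCompact_closedBall _ _).prod isCompact_Icc).exists_bound_of_continuousOn ?_
      refine (hiter M).continuousOn.comp (f := fun y : Z × ℝ => (y.1, (y.2 : ℂ)))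
        (by fun_prop) ?_
      intro y hy
      exact (hRD hy.1).1 _ hy.2
    have hGamma : ∀ c : ℂ, DifferentiableAt ℂ (fun z => (Gamma (α z + c))⁻¹) z₀ := fun c =>
      DifferentiableAt.comp (g := fun s => (Gamma s)⁻¹) z₀
        (differentiable_one_div_Gamma (α z₀ + c)) ((hα z₀).add_const c)
    unfold regMellin
    refine DifferentiableAt.add (DifferentiableAt.fun_sum fun i _ => ?_)
      (((hGamma M).const_mul _).mul ?_)
    · refine ((hat i 1 z₀ (by simpa using hz₀ 1 (by simp))).const_mul _).mul ?_
      simpa [add_assoc] using hGamma (i + 1)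
    · simp only [intervalIntegral.integral_of_le zero_le_one]
      refine differentiableAt_integral_of_dominated hR (g := fun _ => C)
        (integrableOn_const (by simp)) ?_ ?_ ?_
      · intro z hz
        have hz' := hRD (Metric.ball_subset_closedBall hz)
        refine ContinuousOn.aestronglyMeasurable ?_ measurableSet_Ioc
        refine ContinuousOn.mono (s := Set.Icc 0 1) ?_ Set.Ioc_subset_Icc_self
        refine (Continuous.continuousOn (continuous_ofReal_cpow_const ?_)).mul
          (continuousOn_iteratedDeriv (hDz z) (hhz z) hz'.1 M)
        rw [sub_re, one_re]
        linarith [hz'.2]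
      · refine (ae_restrict_iff' measurableSet_Ioc).2 (Eventually.of_forall fun t ht z hz => ?_)
        have hz' := hRD (Metric.ball_subset_closedBall hz)
        refine DifferentiableAt.differentiableWithinAt (DifferentiableAt.mul ?_
          (hat M t z (hz'.1 t ⟨ht.1.le, ht.2⟩)))
        exact (((hα z).add_const _).sub_const _).const_cpow (Or.inl (by
          exact_mod_cast ht.1.ne'))
      · refine (ae_restrict_iff' measurableSet_Ioc).2 (Eventually.of_forall fun t ht z hz => ?_)
        have hz' := hRD (Metric.ball_subset_closedBall hz)
        rw [norm_mul, norm_cpow_eq_rpow_re_of_pos ht.1]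
        have h1 : t ^ (α z + M - 1).re ≤ 1 := by
          refine Real.rpow_le_one ht.1.le ht.2 ?_
          rw [sub_re, one_re]
          linarith [hz'.2]
        have h2 := hC (z, t) ⟨Metric.ball_subset_closedBall hz, ht.1.le, ht.2⟩
        calc _ ≤ 1 * C := mul_le_mul h1 h2 (norm_nonneg _) zero_le_one
          _ = C := one_mul C
  · intro z hz hre
    simp only
    rw [hNM z hz 0 (by simpa using hre)]
    simp only [regMellin, Finset.range_zero, Finset.sum_empty, zero_add, pow_zero, one_mul,
      Nat.cast_zero, add_zero, iteratedDeriv_zero]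
    rw [mul_inv_cancel_left₀ (Gamma_ne_zero_of_re_pos hre)]
  · intro z hz e he
    simp only
    rw [hNM z hz (e + 1) (by simp [he]), he]
    exact regMellin_neg_nat (hDz z) (hhz z) hz e

/-- The polynomial functions on `ℂ^n` all of whose coefficients lie in `W`. -/
noncomputable def polyFun (W : Submodule ℚ ℂ) (n : ℕ) : Submodule ℚ ((Fin n → ℂ) → ℂ) :=
  Submodule.span ℚ {f | ∃ w ∈ W, ∃ α : Fin n → ℕ, f = fun y => w * ∏ i, y i ^ α i}

section polyFun

variable {W : Submodule ℚ ℂ} {n : ℕ}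

theorem monomial_mem_polyFun {w : ℂ} (hw : w ∈ W) (α : Fin n → ℕ) :
    (fun y : Fin n → ℂ => w * ∏ i, y i ^ α i) ∈ polyFun W n :=
  Submodule.subset_span ⟨w, hw, α, rfl⟩

theorem const_mem_polyFun {w : ℂ} (hw : w ∈ W) : (fun _ : Fin n → ℂ => w) ∈ polyFun W n := by
  simpa using monomial_mem_polyFun hw (0 : Fin n → ℕ)

theorem ratCast_mem_one (q : ℚ) : (q : ℂ) ∈ (1 : Submodule ℚ ℂ) :=
  Submodule.mem_one.2 ⟨q, rfl⟩

theorem ratCast_mul_mem (q : ℚ) {w : ℂ} (hw : w ∈ W) : (q : ℂ) * w ∈ W := by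
  have := W.smul_mem q hw
  rwa [Rat.smul_def] at this

theorem proj_mem_polyFun (i : Fin n) : (fun y : Fin n → ℂ => y i) ∈ polyFun 1 n := by
  have := monomial_mem_polyFun (n := n) (ratCast_mem_one 1) (Pi.single i 1)
  convert this using 2 with y
  rw [Finset.prod_eq_single i]
  · simp
  · intro j _ hj; simp [hj]
  · simp

theorem mul_mem_polyFun {f g : (Fin n → ℂ) → ℂ} (hf : f ∈ polyFun 1 n) (hg : g ∈ polyFun W n) :
    (fun y => f y * g y) ∈ polyFun W n := by
  induction hf using Submodule.span_induction with
  | mem f hf =>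
    obtain ⟨w, hw, α, rfl⟩ := hf
    obtain ⟨q, rfl⟩ := Submodule.mem_one.1 hw
    induction hg using Submodule.span_induction with
    | mem g hg =>
      obtain ⟨w, hw, β, rfl⟩ := hg
      convert monomial_mem_polyFun (ratCast_mul_mem q hw) (α + β) using 2 with y
      simp only [Pi.add_apply, pow_add, Finset.prod_mul_distrib, eq_ratCast]
      ring
    | zero => simp only [Pi.zero_apply, mul_zero]; exact (polyFun W n).zero_mem
    | add a b _ _ ha hb => simp only [Pi.add_apply, mul_add]; exact (polyFun W n).add_mem ha hb
    | smul r a _ ha =>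
      convert (polyFun W n).smul_mem r ha using 1
      ext y
      simp only [Pi.smul_apply, Rat.smul_def]
      ring
  | zero => simp only [Pi.zero_apply, zero_mul]; exact (polyFun W n).zero_mem
  | add a b _ _ ha hb => simp only [Pi.add_apply, add_mul]; exact (polyFun W n).add_mem ha hb
  | smul r a _ ha =>
    convert (polyFun W n).smul_mem r ha using 1
    ext y
    simp only [Pi.smul_apply, Rat.smul_def]
    ring

theorem pow_mem_polyFun {f : (Fin n → ℂ) → ℂ} (hf : f ∈ polyFun 1 n) (e : ℕ) :
    (fun y => f y ^ e) ∈ polyFun 1 n := by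
  induction e with
  | zero => simpa using const_mem_polyFun (n := n) (ratCast_mem_one 1)
  | succ e ih => simpa [pow_succ] using mul_mem_polyFun ih hf

theorem prod_mem_polyFun {ι : Type*} (s : Finset ι) {f : ι → (Fin n → ℂ) → ℂ}
    (hf : ∀ i ∈ s, f i ∈ polyFun 1 n) : (fun y => ∏ i ∈ s, f i y) ∈ polyFun 1 n := by
  classical
  induction s using Finset.induction_on with
  | empty => simpa using const_mem_polyFun (n := n) (ratCast_mem_one 1)
  | insert a s ha ih =>
    simp only [Finset.prod_insert ha]
    exact mul_mem_polyFun (hf a (by simp)) (ih fun i hi => hf i (by simp [hi]))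

theorem sum_mem_polyFun {ι : Type*} (s : Finset ι) {f : ι → (Fin n → ℂ) → ℂ}
    (hf : ∀ i ∈ s, f i ∈ polyFun W n) : (fun y => ∑ i ∈ s, f i y) ∈ polyFun W n := by
  convert (polyFun W n).sum_mem hf using 1
  ext y
  simp

theorem comp_mem_polyFun {N : ℕ} {f : (Fin N → ℂ) → ℂ} (hf : f ∈ polyFun W N)
    {φ : Fin N → (Fin n → ℂ) → ℂ} (hφ : ∀ i, φ i ∈ polyFun 1 n) :
    (fun y => f (fun i => φ i y)) ∈ polyFun W n := by
  induction hf using Submodule.span_induction with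
  | mem f hf =>
    obtain ⟨w, hw, α, rfl⟩ := hf
    have := mul_mem_polyFun (prod_mem_polyFun Finset.univ fun i _ => pow_mem_polyFun (hφ i) (α i))
      (const_mem_polyFun (n := n) hw)
    simpa only [mul_comm w] using this
  | zero => exact (polyFun W n).zero_mem
  | add a b _ _ ha hb => exact (polyFun W n).add_mem ha hb
  | smul r a _ ha => exact (polyFun W n).smul_mem r ha

theorem contDiff_of_mem_polyFun {f : (Fin n → ℂ) → ℂ} (hf : f ∈ polyFun W n) :
    ContDiff ℂ ⊤ f := by
  induction hf using Submodule.span_induction with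
  | mem f hf =>
    obtain ⟨w, hw, α, rfl⟩ := hf
    fun_prop
  | zero => exact contDiff_const
  | add a b _ _ ha hb => exact ha.add hb
  | smul r a _ ha =>
    have : r • a = fun y => (r : ℂ) * a y := by
      ext y
      simp [Rat.smul_def]
    rw [this]
    exact contDiff_const.mul ha

theorem contDiff_ray {f : (Fin n → ℂ) → ℂ} (hf : f ∈ polyFun W n) (y : Fin n → ℂ) :
    ContDiff ℂ ⊤ (fun τ : ℂ => f (τ • y)) :=
  (contDiff_of_mem_polyFun hf).comp (contDiff_id.smul contDiff_const)

/-- The derivatives at the origin along rays of a polynomial function with coefficients in `W`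
are again polynomial in the direction, with coefficients in `W`. -/
theorem iteratedDeriv_ray_mem_polyFun {f : (Fin n → ℂ) → ℂ} (hf : f ∈ polyFun W n) (e : ℕ) :
    (fun y => iteratedDeriv e (fun τ : ℂ => f (τ • y)) 0) ∈ polyFun W n := by
  induction hf using Submodule.span_induction with
  | mem f hf =>
    obtain ⟨w, hw, α, rfl⟩ := hf
    have key : ∀ y : Fin n → ℂ, iteratedDeriv e (fun τ : ℂ => w * ∏ i, (τ • y) i ^ α i) 0 =
        (if ∑ i, α i = e then (e.factorial : ℂ) else 0) * (w * ∏ i, y i ^ α i) := by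
      intro y
      have h1 : (fun τ : ℂ => w * ∏ i, (τ • y) i ^ α i) =
          fun τ : ℂ => (w * ∏ i, y i ^ α i) * τ ^ (∑ i, α i) := by
        ext τ
        simp only [Pi.smul_apply, smul_eq_mul, mul_pow, Finset.prod_mul_distrib,
          Finset.prod_pow_eq_pow_sum]
        ring
      rw [h1, iteratedDeriv_const_mul_field, iteratedDeriv_fun_pow_zero]
      simp only [eq_comm (a := e)]
      split_ifs with h
      · rw [h, mul_comm]
      · simp
    simp only [key]
    split_ifs with h
    · have := mul_mem_polyFun (const_mem_polyFun (n := n) (ratCast_mem_one e.factorial))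
        (monomial_mem_polyFun hw α)
      simpa using this
    · simp only [zero_mul]; exact (polyFun W n).zero_mem
  | zero =>
    convert (polyFun W n).zero_mem using 1
    ext y
    simp
  | add a b ha' hb' ha hb =>
    convert (polyFun W n).add_mem ha hb using 1
    ext y
    exact iteratedDeriv_fun_add ((contDiff_ray ha' y).contDiffAt.of_le le_top)
        ((contDiff_ray hb' y).contDiffAt.of_le le_top)
  | smul r a ha' ha =>
    convert (polyFun W n).smul_mem r ha using 1
    ext y
    simp only [Pi.smul_apply, Rat.smul_def]
    exact iteratedDeriv_const_mul_field _ _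

/-- The Taylor coefficients along rays of a quotient `f / g` of polynomial functions. -/
theorem iteratedDeriv_div_ray_mem_polyFun {f g : (Fin n → ℂ) → ℂ} (hf : f ∈ polyFun W n)
    (hg : g ∈ polyFun 1 n) {q : ℚ} (hq : q ≠ 0) (hg0 : g 0 = q) (e : ℕ) :
    (fun y => iteratedDeriv e (fun τ : ℂ => f (τ • y) / g (τ • y)) 0) ∈ polyFun W n := by
  have hqC : (q : ℂ) ≠ 0 := by exact_mod_cast hq
  induction e using Nat.strong_induction_on with
  | _ e ih =>
  have hcd : ∀ y, ContDiffAt ℂ ⊤ (fun τ : ℂ => f (τ • y) / g (τ • y)) 0 := fun y =>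
    (contDiff_ray hf y).contDiffAt.div (contDiff_ray hg y).contDiffAt (by simp [hg0, hqC])
  have key : ∀ y, iteratedDeriv e (fun τ : ℂ => f (τ • y) / g (τ • y)) 0 =
      (q⁻¹ : ℚ) * (iteratedDeriv e (fun τ : ℂ => f (τ • y)) 0 -
        ∑ i ∈ Finset.range e, (e.choose i : ℂ) *
          (iteratedDeriv (e - i) (fun τ : ℂ => g (τ • y)) 0 *
          iteratedDeriv i (fun τ : ℂ => f (τ • y) / g (τ • y)) 0)) := by
    intro y
    have hne : ∀ᶠ τ : ℂ in 𝓝 0, g (τ • y) ≠ 0 :=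
      (contDiff_ray hg y).continuous.continuousAt.eventually_ne (by simp [hg0, hqC])
    have heq : (fun τ : ℂ => (f (τ • y) / g (τ • y)) * g (τ • y)) =ᶠ[𝓝 0] fun τ => f (τ • y) := by
      filter_upwards [hne] with τ hτ
      exact div_mul_cancel₀ _ hτ
    have h1 := heq.iteratedDeriv_eq e
    rw [iteratedDeriv_fun_mul ((hcd y).of_le le_top) ((contDiff_ray hg y).contDiffAt.of_le le_top),
      Finset.sum_range_succ] at h1
    rw [← h1]
    simp only [Nat.choose_self, Nat.sub_self, iteratedDeriv_zero, zero_smul, hg0]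
    push_cast
    field_simp
    rw [add_sub_right_comm, ← Finset.sum_sub_distrib, Finset.sum_eq_zero fun i _ => by ring,
      zero_add]
  simp only [key]
  refine mul_mem_polyFun (const_mem_polyFun (ratCast_mem_one _)) ((polyFun W n).sub_mem
    (iteratedDeriv_ray_mem_polyFun hf e) (sum_mem_polyFun _ fun i hi => ?_))
  refine mul_mem_polyFun ?_ (mul_mem_polyFun (iteratedDeriv_ray_mem_polyFun hg _)
    (ih i (Finset.mem_range.1 hi)))
  simpa using const_mem_polyFun (n := n) (ratCast_mem_one (e.choose i))

end polyFun

theorem meromorphicAt_Gamma_comp {α : ℂ → ℂ} (hα : Differentiable ℂ α) (z : ℂ) :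
    MeromorphicAt (fun s => Gamma (α s)) z := by
  have h : Differentiable ℂ fun s => (Gamma (α s))⁻¹ := differentiable_one_div_Gamma.comp hα
  simpa using (h.analyticAt z).meromorphicAt.fun_inv

/-- `Γ` has rational residues at the nonpositive integers. -/
theorem exists_rat_tendsto_mul_Gamma (e : ℕ) :
    ∃ q : ℚ, Tendsto (fun z : ℂ => z * Gamma (z - e)) (𝓝[≠] 0) (𝓝 (q : ℂ)) := by
  induction e with
  | zero => exact ⟨1, by simpa using tendsto_self_mul_Gamma_nhds_zero⟩
  | succ e ih =>
    obtain ⟨q, hq⟩ := ih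
    refine ⟨q / (-(e + 1 : ℕ)), ?_⟩
    have hne : (-((e + 1 : ℕ) : ℂ)) ≠ 0 := by
      rw [neg_ne_zero]; exact_mod_cast e.succ_ne_zero
    have hc : Tendsto (fun z : ℂ => z - ((e + 1 : ℕ) : ℂ)) (𝓝[≠] 0) (𝓝 (-((e + 1 : ℕ) : ℂ))) := by
      have : ContinuousAt (fun z : ℂ => z - ((e + 1 : ℕ) : ℂ)) 0 := by fun_prop
      simpa only [zero_sub, neg_add_cancel] using this.tendsto.mono_left nhdsWithin_le_nhds
    have h2 := hq.div hc hne
    push_cast at h2 ⊢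
    refine h2.congr' ?_
    have h0 : ∀ᶠ z : ℂ in 𝓝[≠] 0, z - ((e : ℂ) + 1) ≠ 0 := by
      have := hc.eventually_ne hne
      push_cast at this
      exact this
    filter_upwards [h0] with z hz
    have := Gamma_add_one _ hz
    rw [show z - (e + 1 : ℂ) + 1 = z - e by ring] at this
    rw [Pi.div_apply, this]
    field_simp

theorem exists_rat_tendsto_Gamma_affine (k m n : ℕ) :
    ∃ q : ℚ, Tendsto (fun s : ℂ => (s + m) * Gamma (k * s + n + 1)) (𝓝[≠] (-(m : ℂ))) (𝓝 (q : ℂ)) ∧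
      (m * k < n + 1 → q = 0) := by
  have hs : Tendsto (fun s : ℂ => s + m) (𝓝[≠] (-(m : ℂ))) (𝓝 0) := by
    have : ContinuousAt (fun z : ℂ => z + m) (-m) := by fun_prop
    simpa only [zero_sub, neg_add_cancel] using this.tendsto.mono_left nhdsWithin_le_nhds
  by_cases h : m * k < n + 1
  · refine ⟨0, ?_, fun _ => rfl⟩
    have hd : ContinuousAt (fun s : ℂ => Gamma (k * s + n + 1)) (-m) := by
      refine ContinuousAt.comp (f := fun s : ℂ => (k * s + n + 1 : ℂ)) (g := Gamma) ?_ (by fun_prop)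
      refine (differentiableAt_Gamma _ fun j hj => ?_).continuousAt
      have h1 : (n + 1 + j : ℂ) = m * k := by linear_combination hj
      have h2 : n + 1 + j = m * k := by exact_mod_cast h1
      omega
    simpa using hs.mul (hd.tendsto.mono_left nhdsWithin_le_nhds)
  · obtain ⟨e, he⟩ : ∃ e, m * k = n + 1 + e := ⟨m * k - (n + 1), by omega⟩
    have hk : (k : ℂ) ≠ 0 := by
      rintro h0
      have : k = 0 := by exact_mod_cast h0
      subst this
      omega
    obtain ⟨q, hq⟩ := exists_rat_tendsto_mul_Gamma e
    refine ⟨q / k, ?_, fun h' => absurd h' h⟩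
    have hs' : Tendsto (fun s : ℂ => k * (s + m)) (𝓝[≠] (-(m : ℂ))) (𝓝[≠] 0) := by
      refine tendsto_nhdsWithin_iff.2 ⟨by simpa using hs.const_mul (k : ℂ), ?_⟩
      filter_upwards [self_mem_nhdsWithin] with s hs
      simp only [Set.mem_compl_iff, Set.mem_singleton_iff] at hs ⊢
      exact mul_ne_zero hk fun h => hs (eq_neg_of_add_eq_zero_left h)
    have h3 := (hq.comp hs').div_const (k : ℂ)
    push_cast
    refine h3.congr fun s => ?_
    have he' : (m * k : ℂ) = n + 1 + e := by exact_mod_cast he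
    rw [Function.comp_apply, show (k * (s + m) - e : ℂ) = k * s + n + 1 by linear_combination he']
    field_simp

section cone

variable {n : ℕ}

theorem volume_setOf_eq_apply {i j : Fin (n + 1)} (hij : i ≠ j) :
    volume {t : Fin (n + 1) → ℝ | t i = t j} = 0 := by
  let S : Submodule ℝ (Fin (n + 1) → ℝ) :=
    LinearMap.ker ((LinearMap.proj i : (Fin (n + 1) → ℝ) →ₗ[ℝ] ℝ) - LinearMap.proj j)
  have hS : S ≠ ⊤ := by
    intro h
    have : (Pi.single i 1 : Fin (n + 1) → ℝ) ∈ S := h ▸ Submodule.mem_top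
    simp [S, hij.symm] at this
  have := Measure.addHaar_submodule (volume : Measure (Fin (n + 1) → ℝ)) S hS
  convert this using 2
  ext t
  simp [S, sub_eq_zero]

/-- The part of `D` where the `i`-th coordinate is maximal. -/
def maxPart (D : Set (Fin (n + 1) → ℝ)) (i : Fin (n + 1)) : Set (Fin (n + 1) → ℝ) :=
  D ∩ {t | ∀ j, t j ≤ t i}

theorem measurableSet_maxPart {D : Set (Fin (n + 1) → ℝ)} (hD : MeasurableSet D)
    (i : Fin (n + 1)) : MeasurableSet (maxPart D i) := by
  refine hD.inter ?_
  simp only [Set.ofPred_forall]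
  exact MeasurableSet.iInter fun j => measurableSet_le (measurable_pi_apply _) (measurable_pi_apply _)

theorem setIntegral_eq_sum_maxPart {D : Set (Fin (n + 1) → ℝ)} (hD : MeasurableSet D)
    {f : (Fin (n + 1) → ℝ) → ℂ} (hf : IntegrableOn f D) :
    ∫ t in D, f t = ∑ i, ∫ t in maxPart D i, f t := by
  have hU : D = ⋃ i, maxPart D i := by
    ext t
    simp only [maxPart, Set.mem_iUnion, Set.mem_inter_iff, Set.mem_ofPred_eq, exists_and_left,
      iff_self_and]
    intro _
    obtain ⟨i, hi⟩ := Finite.exists_max t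
    exact ⟨i, hi⟩
  have := integral_iUnion_ae (μ := volume) (f := f) (s := maxPart D)
    (fun i => (measurableSet_maxPart hD i).nullMeasurableSet) (fun i j hij => by
      refine measure_mono_null (fun t ht => ?_) (volume_setOf_eq_apply hij)
      exact le_antisymm (ht.2.2 i) (ht.1.2 j)) (by rwa [← hU])
  rw [← hU] at this
  rw [this, tsum_fintype]

theorem smul_insertNth_mem_maxPart_iff {D : Set (Fin (n + 1) → ℝ)}
    (hD : ∀ t ∈ D, ∀ i, 0 ≤ t i) {i : Fin (n + 1)} {τ : ℝ} (hτ : 0 < τ) {u : Fin n → ℝ} :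
    τ • i.insertNth (α := fun _ => ℝ) 1 u ∈ maxPart D i ↔
      u ∈ Set.Icc 0 1 ∧ τ • i.insertNth (α := fun _ => ℝ) 1 u ∈ D := by
  simp only [maxPart, Set.mem_inter_iff, Set.mem_ofPred_eq]
  constructor
  · rintro ⟨h1, h2⟩
    refine ⟨⟨fun j => ?_, fun j => ?_⟩, h1⟩
    · have := hD _ h1 (i.succAbove j)
      simpa [hτ] using this
    · have := h2 (i.succAbove j)
      simpa [hτ] using this
  · rintro ⟨h1, h2⟩
    refine ⟨h2, fun j => ?_⟩
    induction j using Fin.succAboveCases i with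
    | x => rfl
    | p j =>
      have := h1.2 j
      simpa [hτ] using this

theorem integral_maxPart {D : Set (Fin (n + 1) → ℝ)} (hD : MeasurableSet D)
    (hD01 : D ⊆ Set.Icc 0 1) {T : (Fin n → ℝ) → ℝ} (hT0 : ∀ u ∈ Set.Icc 0 1, 0 < T u)
    (i : Fin (n + 1))
    (hT : ∀ u ∈ Set.Icc 0 1, ∀ τ : ℝ, 0 < τ →
      (τ • i.insertNth (α := fun _ => ℝ) 1 u ∈ D ↔ τ ≤ T u))
    {f : (Fin (n + 1) → ℝ) → ℂ} (hf : Measurable (D.indicator f)) {C : ℝ}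
    (hC : ∀ t ∈ D, ‖f t‖ ≤ C) :
    ∫ t in maxPart D i, f t =
      ∫ u in Set.Icc (0 : Fin n → ℝ) 1, ∫ w in (0 : ℝ)..1,
        (w : ℂ) ^ n * ((T u : ℂ) ^ (n + 1) * f ((w * T u) • i.insertNth (α := fun _ => ℝ) 1 u)) := by
  have hDi := measurableSet_maxPart hD i
  set F := (maxPart D i).indicator f with hFdef
  have hFD : F = (maxPart D i).indicator (D.indicator f) := by
    rw [Set.indicator_indicator, Set.inter_eq_left.2 (show maxPart D i ⊆ D from Set.inter_subset_left)]
  have hFm : Measurable F := hFD ▸ hf.indicator hDi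
  have hFC : ∀ t, ‖F t‖ ≤ max C 0 := by
    intro t
    by_cases ht : t ∈ maxPart D i
    · rw [hFdef, Set.indicator_of_mem ht]
      exact (hC t ht.1).trans (le_max_left _ _)
    · simp [hFdef, Set.indicator_of_notMem ht]
  have hvol : volume (Set.Icc (0 : Fin (n + 1) → ℝ) 1) ≠ ⊤ := isCompact_Icc.measure_lt_top.ne
  have hFi : Integrable F := by
    rw [hFdef, integrable_indicator_iff hDi]
    refine IntegrableOn.mono_set (t := Set.Icc 0 1) ?_ (Set.inter_subset_left.trans hD01) |>.congr_fun
      (f := F) (fun t ht => Set.indicator_of_mem ht _) hDi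
    exact Measure.integrableOn_of_bounded hvol hFm.aestronglyMeasurable (ae_of_all _ hFC)
  have h1 : ∫ t in maxPart D i, f t =
      ∫ τ : ℝ, ∫ x : Fin n → ℝ, F (i.insertNth (α := fun _ => ℝ) τ x) := by
    rw [← integral_indicator hDi]
    have hmp := (volume_preserving_piFinSuccAbove (fun _ : Fin (n + 1) => ℝ) i).symm
    rw [← hmp.integral_comp' F, Measure.volume_eq_prod, integral_prod]
    · rfl
    · exact (hmp.integrable_comp_of_integrable hFi)
  have hslice : ∀ τ : ℝ, 0 < τ → ∫ x : Fin n → ℝ, F (i.insertNth (α := fun _ => ℝ) τ x) =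
      ∫ u in Set.Icc (0 : Fin n → ℝ) 1, (τ : ℂ) ^ n * F (τ • i.insertNth (α := fun _ => ℝ) 1 u) := by
    intro τ hτ
    have h2 := Measure.integral_comp_smul (volume : Measure (Fin n → ℝ))
      (fun x => F (i.insertNth (α := fun _ => ℝ) τ x)) τ
    have h3 : ∀ u : Fin n → ℝ, i.insertNth (α := fun _ => ℝ) τ (τ • u) =
        τ • i.insertNth (α := fun _ => ℝ) 1 u := by
      intro u
      ext j
      induction j using Fin.succAboveCases i <;> simp
    simp only [h3, Module.finrank_fintype_fun_eq_card, Fintype.card_fin] at h2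
    have h4 : ∀ u ∉ Set.Icc (0 : Fin n → ℝ) 1, F (τ • i.insertNth (α := fun _ => ℝ) 1 u) = 0 :=
      fun u hu => Set.indicator_of_notMem
        (fun h => hu ((smul_insertNth_mem_maxPart_iff (fun t ht => (hD01 ht).1) hτ).1 h).1) _
    rw [integral_const_mul, setIntegral_eq_integral_of_forall_compl_eq_zero h4, h2,
      abs_of_pos (by positivity), Complex.real_smul]
    push_cast
    rw [mul_inv_cancel_left₀ (by exact_mod_cast (pow_pos hτ n).ne')]
  have h5 : ∫ t in maxPart D i, f t = ∫ τ in Set.Ioc (0 : ℝ) 1,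
      ∫ u in Set.Icc (0 : Fin n → ℝ) 1, (τ : ℂ) ^ n * F (τ • i.insertNth (α := fun _ => ℝ) 1 u) := by
    rw [h1, ← setIntegral_congr_fun measurableSet_Ioc fun τ hτ => hslice τ hτ.1,
      ← integral_Icc_eq_integral_Ioc, setIntegral_eq_integral_of_forall_compl_eq_zero]
    intro τ hτ
    rw [integral_eq_zero_of_ae (ae_of_all _ fun x => ?_)]
    refine Set.indicator_of_notMem (fun h => hτ ?_) _
    have := hD01 h.1
    have h0 := this.1 i
    have h1 := this.2 i
    simp only [Fin.insertNth_apply_same] at h0 h1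
    exact ⟨h0, h1⟩
  rw [h5, integral_integral_swap]
  · refine setIntegral_congr_fun measurableSet_Icc fun u hu => ?_
    have hT1 : T u ≤ 1 := by
      have := (hD01 ((hT u hu _ (hT0 u hu)).2 le_rfl)).2 i
      simpa using this
    have hsub := intervalIntegral.smul_integral_comp_mul_right (a := 0) (b := 1)
      (fun τ : ℝ => (τ : ℂ) ^ n * f (τ • i.insertNth (α := fun _ => ℝ) 1 u)) (T u)
    have h6 : ∀ w : ℝ, (w : ℂ) ^ n *
        ((T u : ℂ) ^ (n + 1) * f ((w * T u) • i.insertNth (α := fun _ => ℝ) 1 u)) =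
        (T u : ℂ) * (((w * T u : ℝ) : ℂ) ^ n * f ((w * T u) • i.insertNth (α := fun _ => ℝ) 1 u)) := by
      intro w
      push_cast
      ring
    simp only [h6]
    rw [intervalIntegral.integral_const_mul, ← Complex.real_smul, hsub, zero_mul, one_mul,
      intervalIntegral.integral_of_le (hT0 u hu).le]
    rw [setIntegral_eq_of_subset_of_forall_sdiff_eq_zero measurableSet_Ioc
      (Set.Ioc_subset_Ioc_right hT1) (f := fun τ : ℝ =>
        (τ : ℂ) ^ n * F (τ • i.insertNth (α := fun _ => ℝ) 1 u))]
    · refine setIntegral_congr_fun measurableSet_Ioc fun τ hτ => ?_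
      rw [hFdef, Set.indicator_of_mem]
      exact (smul_insertNth_mem_maxPart_iff (fun t ht => (hD01 ht).1) hτ.1).2
        ⟨hu, (hT u hu τ hτ.1).2 hτ.2⟩
    · rintro τ ⟨hτ, hτ'⟩
      rw [hFdef, Set.indicator_of_notMem, mul_zero]
      intro h
      exact hτ' ⟨hτ.1, (hT u hu τ hτ.1).1
        ((smul_insertNth_mem_maxPart_iff (fun t ht => (hD01 ht).1) hτ.1).1 h).2⟩
  · rw [Measure.prod_restrict]
    refine Measure.integrableOn_of_bounded (M := max C 0) ?_ ?_ ?_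
    · rw [Measure.prod_prod]
      exact ENNReal.mul_ne_top (by simp) isCompact_Icc.measure_lt_top.ne
    · refine Measurable.aestronglyMeasurable ?_
      refine Measurable.mul (by fun_prop) (hFm.comp ?_)
      have : Continuous fun x : ℝ × (Fin n → ℝ) => x.1 • i.insertNth (α := fun _ => ℝ) 1 x.2 := by
        refine continuous_fst.smul (continuous_pi fun j => ?_)
        induction j using Fin.succAboveCases i with
        | x => simpa using continuous_const
        | p j => simpa using by fun_prop
      exact this.measurable
    · refine (ae_restrict_iff' (measurableSet_Ioc.prod measurableSet_Icc)).2 (ae_of_all _ ?_)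
      rintro ⟨τ, u⟩ ⟨hτ, -⟩
      simp only [Function.uncurry, norm_mul, norm_pow, norm_real, Real.norm_eq_abs]
      rw [abs_of_pos hτ.1]
      exact (mul_le_mul (pow_le_one₀ hτ.1.le hτ.2) (hFC _) (norm_nonneg _) zero_le_one).trans_eq
        (one_mul _)

/-- Decomposition of an integral over a star-shaped region `D` with gauge `T` into `n + 1` pieces
parametrised by the cube. -/
theorem setIntegral_eq_sum_cone {D : Set (Fin (n + 1) → ℝ)} (hD : MeasurableSet D)
    (hD01 : D ⊆ Set.Icc 0 1) {T : (Fin n → ℝ) → ℝ} (hT0 : ∀ u ∈ Set.Icc 0 1, 0 < T u)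
    (hT : ∀ i : Fin (n + 1), ∀ u ∈ Set.Icc 0 1, ∀ τ : ℝ, 0 < τ →
      (τ • i.insertNth (α := fun _ => ℝ) 1 u ∈ D ↔ τ ≤ T u))
    {f : (Fin (n + 1) → ℝ) → ℂ} (hf : Measurable (D.indicator f)) {C : ℝ}
    (hC : ∀ t ∈ D, ‖f t‖ ≤ C) :
    ∫ t in D, f t = ∑ i : Fin (n + 1),
      ∫ u in Set.Icc (0 : Fin n → ℝ) 1, ∫ w in (0 : ℝ)..1,
        (w : ℂ) ^ n * ((T u : ℂ) ^ (n + 1) * f ((w * T u) • i.insertNth (α := fun _ => ℝ) 1 u)) := by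
  rw [setIntegral_eq_sum_maxPart hD]
  · exact Finset.sum_congr rfl fun i _ => integral_maxPart hD hD01 hT0 i (hT i) hf hC
  · have hvol : volume D ≠ ⊤ := ((measure_mono hD01).trans_lt isCompact_Icc.measure_lt_top).ne
    have := Measure.integrableOn_of_bounded (s := D) (f := D.indicator f) (M := C) hvol
      hf.aestronglyMeasurable ((ae_restrict_iff' hD).2 (ae_of_all _ fun t ht => by
        rw [Set.indicator_of_mem ht]; exact hC t ht))
    exact this.congr_fun (fun t ht => Set.indicator_of_mem ht _) hD

end cone

section cube

variable {n : ℕ}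

/-- All Taylor coefficients of `g` at the origin lie in `W`, expressed through derivatives along
rays. -/
def TaylorMem (W : Submodule ℚ ℂ) (g : (Fin n → ℂ) → ℂ) : Prop :=
  ∀ e, (fun y => iteratedDeriv e (fun τ : ℂ => g (τ • y)) 0) ∈ polyFun W n

/-- Meromorphic continuation over the unit cube of integrals of powers of products of linear forms
with nonnegative rational coefficients, and the leading coefficient at `-m`. -/
def CubeContinuation (m : ℕ) (W : Submodule ℚ ℂ) (n : ℕ) : Prop :=
  ∀ (J : Type) [Fintype J] (a : J → Fin n → ℚ), (∀ j i, 0 ≤ a j i) → (∀ j, a j ≠ 0) →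
    ∀ (D : Set (ℂ × (Fin n → ℂ))) (G : ℂ × (Fin n → ℂ) → ℂ), IsOpen D →
    (∀ (s : ℂ), ∀ u ∈ Set.Icc (0 : Fin n → ℝ) 1, (s, fun i => (u i : ℂ)) ∈ D) →
    DifferentiableOn ℂ G D →
    ∃ F : ℂ → ℂ, (∀ z, MeromorphicAt F z) ∧
      (∀ s : ℂ, 0 < s.re → F s = ∫ u in Set.Icc (0 : Fin n → ℝ) 1,
        (∏ j, ((∑ l, (a j l : ℝ) * u l : ℝ) : ℂ) ^ s) * G (s, fun i => (u i : ℂ))) ∧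
      ∃ L, Tendsto (fun s => (s + (m : ℂ)) ^ n * F s) (𝓝[≠] (-(m : ℂ))) (𝓝 L) ∧
        (TaylorMem W (fun u => G (-(m : ℂ), u)) → L ∈ W)

theorem cpow_nonneg_form {w : ℝ} (hw : 0 < w) {J : Type*} [Fintype J] {x : J → ℝ}
    (hx : ∀ j, 0 ≤ x j) (s : ℂ) :
    ∏ j, ((w * x j : ℝ) : ℂ) ^ s = (w : ℂ) ^ (Fintype.card J * s) * ∏ j, (x j : ℂ) ^ s := by
  simp only [ofReal_mul, mul_cpow_ofReal_nonneg hw.le (hx _), Finset.prod_mul_distrib,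
    Finset.prod_const, cpow_nat_mul, Finset.card_univ]

theorem CubeContinuation.radial {m : ℕ} {W : Submodule ℚ ℂ} (ih : CubeContinuation m W n)
    (i : Fin (n + 1)) {J : Type} [Fintype J] {a : J → Fin (n + 1) → ℚ} (ha : ∀ j l, 0 ≤ a j l)
    (ha0 : ∀ j, a j ≠ 0) {D : Set ((ℂ × (Fin n → ℂ)) × ℂ)} (hD : IsOpen D)
    (hDu : ∀ (s : ℂ), ∀ u ∈ Set.Icc (0 : Fin n → ℝ) 1,
      (s, fun l => (u l : ℂ)) ∈ unitFiberCore D)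
    {g : (ℂ × (Fin n → ℂ)) × ℂ → ℂ} (hg : DifferentiableOn ℂ g D) :
    ∃ F : ℂ → ℂ, (∀ z, MeromorphicAt F z) ∧
      (∀ s : ℂ, 0 < s.re → F s = ∫ u in Set.Icc (0 : Fin n → ℝ) 1, ∫ w in (0 : ℝ)..1,
        (w : ℂ) ^ n * ((∏ j, ((∑ l, (a j l : ℝ) * (w • i.insertNth (α := fun _ => ℝ) 1 u) l : ℝ) : ℂ)
          ^ s) * g ((s, fun l => (u l : ℂ)), w))) ∧
      ∃ L, Tendsto (fun s => (s + (m : ℂ)) ^ (n + 1) * F s) (𝓝[≠] (-(m : ℂ))) (𝓝 L) ∧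
        ((n + 1 ≤ m * Fintype.card J → ∃ P ∈ polyFun W n, ∀ᶠ u in 𝓝 0,
          iteratedDeriv (m * Fintype.card J - (n + 1)) (fun w => g ((-(m : ℂ), u), w)) 0 = P u) →
          L ∈ W) := by
  classical
  set k := Fintype.card J with hk
  obtain ⟨H, hHd, hHint, hHval⟩ := exists_mellin_continuation
    (α := fun z : ℂ × (Fin n → ℂ) => k * z.1 + n + 1) (by fun_prop) hD hg
  let lin : J → (Fin n → ℂ) → ℂ := fun j u => (a j i : ℂ) + ∑ l, (a j (i.succAbove l) : ℂ) * u l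
  let S : Finset J := Finset.univ.filter fun j => a j i ≠ 0
  have hlin : ∀ j, Differentiable ℂ (lin j) := fun j => by fun_prop
  let D' : Set (ℂ × (Fin n → ℂ)) := unitFiberCore D ∩ ⋂ j ∈ S, {z | 0 < (lin j z.2).re}
  have hD'o : IsOpen D' := by
    refine (isOpen_unitFiberCore hD).inter (isOpen_biInter_finset fun j _ => ?_)
    exact isOpen_lt continuous_const
      (continuous_re.comp ((hlin j).continuous.comp continuous_snd))
  have hlinR : ∀ j (u : Fin n → ℝ), lin j (fun l => (u l : ℂ)) =
      ((∑ l, (a j l : ℝ) * i.insertNth (α := fun _ => ℝ) 1 u l : ℝ) : ℂ) := by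
    intro j u
    rw [Fin.sum_univ_succAbove _ i]
    simp [lin]
  have hnn : ∀ j, ∀ u ∈ Set.Icc (0 : Fin n → ℝ) 1,
      0 ≤ ∑ l, (a j l : ℝ) * i.insertNth (α := fun _ => ℝ) 1 u l := by
    intro j u hu
    refine Finset.sum_nonneg fun l _ => mul_nonneg (by exact_mod_cast ha j l) ?_
    induction l using Fin.succAboveCases i with
    | x => simp
    | p l => simpa using hu.1 l
  have hD'u : ∀ (s : ℂ), ∀ u ∈ Set.Icc (0 : Fin n → ℝ) 1, (s, fun l => (u l : ℂ)) ∈ D' := by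
    intro s u hu
    refine ⟨hDu s u hu, Set.mem_iInter₂.2 fun j hj => ?_⟩
    have hj : a j i ≠ 0 := (Finset.mem_filter.1 hj).2
    have hpos : (0 : ℝ) < a j i := by exact_mod_cast lt_of_le_of_ne (ha j i) hj.symm
    simp only [Set.mem_ofPred_eq, hlinR, ofReal_re]
    rw [Fin.sum_univ_succAbove _ i]
    simp only [Fin.insertNth_apply_same, mul_one, Fin.insertNth_apply_succAbove]
    exact add_pos_of_pos_of_nonneg hpos (Finset.sum_nonneg fun l _ =>
      mul_nonneg (by exact_mod_cast ha _ _) (hu.1 l))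
  let G' : ℂ × (Fin n → ℂ) → ℂ := fun z => (∏ j ∈ S, lin j z.2 ^ z.1) * H z
  have hG' : DifferentiableOn ℂ G' D' := by
    refine DifferentiableOn.mul (fun z hz => DifferentiableAt.differentiableWithinAt ?_)
      (hHd.mono Set.inter_subset_left)
    have h1 : ∀ j ∈ S, DifferentiableAt ℂ (fun z : ℂ × (Fin n → ℂ) => lin j z.2 ^ z.1) z :=
      fun j hj => DifferentiableAt.cpow ((hlin j).comp differentiable_snd z) differentiableAt_fst
        (Or.inl (Set.mem_iInter₂.1 hz.2 j hj))
    exact (HasFDerivAt.finsetProd fun j hj => (h1 j hj).hasFDerivAt).differentiableAt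
  obtain ⟨F', hF'm, hF'i, L', hL', hL'W⟩ := ih {j // a j i = 0} (fun j l => a j.1 (i.succAbove l))
    (fun j l => ha _ _) (fun j h => ha0 j.1 (by
      ext l
      induction l using Fin.succAboveCases i with
      | x => exact j.2
      | p l => exact congrFun h l)) D' G' hD'o hD'u hG'
  obtain ⟨q, hq, hq0⟩ := exists_rat_tendsto_Gamma_affine k m n
  refine ⟨fun s => Gamma (k * s + n + 1) * F' s,
    fun z => (meromorphicAt_Gamma_comp (by fun_prop) z).mul (hF'm z), fun s hs => ?_, q * L', ?_,
    fun hP => ?_⟩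
  · simp only
    rw [hF'i s hs, ← integral_const_mul]
    refine setIntegral_congr_fun measurableSet_Icc fun u hu => ?_
    have hαre : 0 < (k * s + n + 1 : ℂ).re := by
      simp only [add_re, mul_re, natCast_re, natCast_im, zero_mul, sub_zero, one_re]
      positivity
    have h1 := hHint _ (hDu s u hu) hαre
    have h2 : (∏ j : {j // a j i = 0}, ((∑ l, (a j.1 (i.succAbove l) : ℝ) * u l : ℝ) : ℂ) ^ s) *
        ∏ j ∈ S, lin j (fun l => (u l : ℂ)) ^ s = ∏ j, lin j (fun l => (u l : ℂ)) ^ s := by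
      rw [← Finset.prod_filter_mul_prod_filter_not Finset.univ (fun j => a j i = 0)]
      congr 1
      rw [← Finset.prod_subtype_eq_prod_filter]
      simp only [Finset.subtype_univ]
      refine Finset.prod_congr rfl fun j _ => ?_
      congr 1
      simp [lin, j.2]
    have h3 : ∫ w in (0 : ℝ)..1,
        (w : ℂ) ^ n * ((∏ j, ((∑ l, (a j l : ℝ) * (w • i.insertNth (α := fun _ => ℝ) 1 u) l : ℝ) : ℂ)
          ^ s) * g ((s, fun l => (u l : ℂ)), w)) =
        (∏ j, lin j (fun l => (u l : ℂ)) ^ s) * ∫ w in (0 : ℝ)..1,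
          (w : ℂ) ^ (k * s + n + 1 - 1 : ℂ) * g ((s, fun l => (u l : ℂ)), w) := by
      rw [← intervalIntegral.integral_const_mul]
      refine intervalIntegral.integral_congr_ae (ae_of_all _ fun w hw => ?_)
      rw [Set.uIoc_of_le zero_le_one] at hw
      have h4 : ∀ j, ∑ l, (a j l : ℝ) * (w • i.insertNth (α := fun _ => ℝ) 1 u) l =
          w * ∑ l, (a j l : ℝ) * i.insertNth (α := fun _ => ℝ) 1 u l := by
        intro j
        rw [Finset.mul_sum]
        exact Finset.sum_congr rfl fun l _ => by simp; ring
      simp only [h4]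
      rw [cpow_nonneg_form hw.1 (fun j => hnn j u hu), add_sub_cancel_right,
        cpow_add _ _ (by exact_mod_cast hw.1.ne'), cpow_natCast, ← hk]
      simp only [hlinR]
      ring
    simp only [G']
    rw [h3, h1, ← h2]
    ring
  · refine (hq.mul hL').congr fun s => ?_
    ring
  · by_cases hmk : m * k < n + 1
    · rw [hq0 hmk]
      simp
    obtain ⟨P, hPW, hP⟩ := hP (not_lt.1 hmk)
    refine ratCast_mul_mem q (hL'W ?_)
    set e := m * k - (n + 1) with he
    have hαe : (k * (-m : ℂ) + n + 1 : ℂ) = -e := by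
      have : m * k = e + (n + 1) := by omega
      have : (m * k : ℂ) = e + (n + 1) := by exact_mod_cast this
      linear_combination -this
    have hlinmem : ∀ j, lin j ∈ polyFun 1 n := fun j =>
      (polyFun 1 n).add_mem (const_mem_polyFun (ratCast_mem_one _)) (sum_mem_polyFun _ fun l _ =>
        mul_mem_polyFun (const_mem_polyFun (ratCast_mem_one _)) (proj_mem_polyFun l))
    have hQ : (fun u => ∏ j ∈ S, lin j u ^ m) ∈ polyFun 1 n :=
      prod_mem_polyFun S fun j _ => pow_mem_polyFun (hlinmem j) m
    have hQ0 : (fun u => ∏ j ∈ S, lin j u ^ m) 0 = ((∏ j ∈ S, a j i ^ m : ℚ) : ℂ) := by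
      simp [lin]
    have hP' : (fun u => (((-1) ^ e : ℚ) : ℂ) * P u) ∈ polyFun W n :=
      mul_mem_polyFun (const_mem_polyFun (ratCast_mem_one _)) hPW
    have h0 : (-(m : ℂ), (0 : Fin n → ℂ)) ∈ unitFiberCore D := by
      have := hDu (-m) 0 ⟨le_rfl, zero_le_one⟩
      simp only [Pi.zero_apply, ofReal_zero] at this
      exact this
    have hev : ∀ᶠ u in 𝓝 (0 : Fin n → ℂ), G' (-(m : ℂ), u) =
        (((-1) ^ e : ℚ) : ℂ) * P u / ∏ j ∈ S, lin j u ^ m := by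
      have hev0 : ∀ᶠ u in 𝓝 (0 : Fin n → ℂ), (-(m : ℂ), u) ∈ unitFiberCore D :=
        ((isOpen_unitFiberCore hD).preimage
          (f := fun u : Fin n → ℂ => (-(m : ℂ), u)) (by fun_prop)).mem_nhds h0
      filter_upwards [hP, hev0] with u hu hu0
      simp only [G']
      rw [hHval _ hu0 e hαe, hu]
      simp only [cpow_neg, cpow_natCast, Finset.prod_inv_distrib]
      push_cast
      rw [div_eq_inv_mul]
    intro e'
    have := iteratedDeriv_div_ray_mem_polyFun hP' hQ
      (Finset.prod_ne_zero_iff.2 fun j hj => pow_ne_zero m (Finset.mem_filter.1 hj).2) hQ0 e'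
    convert this using 2 with y
    refine EventuallyEq.iteratedDeriv_eq e' ?_
    have hc : Tendsto (fun τ : ℂ => τ • y) (𝓝 0) (𝓝 0) := by
      have : Continuous fun τ : ℂ => τ • y := by fun_prop
      simpa using this.tendsto 0
    exact hc.eventually hev

end cube

section star

variable {n : ℕ}

theorem iteratedDeriv_comp_const_mul_field (e : ℕ) (φ : ℂ → ℂ) (c : ℂ) :
    iteratedDeriv e (fun w => φ (c * w)) = fun w => c ^ e * iteratedDeriv e φ (c * w) := by
  induction e with
  | zero => simp
  | succ e ih =>
    ext w
    rw [iteratedDeriv_succ, ih, deriv_const_mul_field, deriv_comp_mul_left c (iteratedDeriv e φ),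
      ← iteratedDeriv_succ, smul_eq_mul]
    ring

theorem inv_mem_slitPlane {z : ℂ} (hz : z ∈ slitPlane) : z⁻¹ ∈ slitPlane := by
  have hπ := slitPlane_arg_ne_pi hz
  refine mem_slitPlane_iff_arg.2 ⟨fun h => ?_, inv_ne_zero (slitPlane_ne_zero hz)⟩
  rw [arg_inv, if_neg hπ] at h
  linarith [neg_pi_lt_arg z]

/-- Meromorphic continuation, and leading coefficient at `-m`, of integrals of powers of products
of linear forms over a region star-shaped about the origin. -/
theorem CubeContinuation.star {m : ℕ} {W : Submodule ℚ ℂ} (ih : CubeContinuation m W n)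
    {J : Type} [Fintype J] {a : J → Fin (n + 1) → ℚ} (ha : ∀ j l, 0 ≤ a j l)
    (ha0 : ∀ j, a j ≠ 0) {K : Set (Fin (n + 1) → ℝ)} (hK : IsClosed K) (hK01 : K ⊆ Set.Icc 0 1)
    (hK0 : 0 ∈ K) {ε : ℝ} (hε : 0 ≤ ε)
    (hKT : ∀ i : Fin (n + 1), ∀ u ∈ Set.Icc (0 : Fin n → ℝ) 1, ∀ τ : ℝ, 0 < τ →
      (τ • i.insertNth (α := fun _ => ℝ) 1 u ∈ K ↔ τ * (1 + ε * ∑ l, u l) ≤ 1))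
    {D : Set (ℂ × (Fin (n + 1) → ℂ))} (hD : IsOpen D) {G : ℂ × (Fin (n + 1) → ℂ) → ℂ}
    (hDK : ∀ s : ℂ, ∀ t ∈ K, (s, fun l => (t l : ℂ)) ∈ D) (hG : DifferentiableOn ℂ G D) :
    ∃ F : ℂ → ℂ, (∀ z, MeromorphicAt F z) ∧
      (∀ s : ℂ, 0 < s.re → F s = ∫ t in K,
        (∏ j, ((∑ l, (a j l : ℝ) * t l : ℝ) : ℂ) ^ s) * G (s, fun l => (t l : ℂ))) ∧
      ∃ L, Tendsto (fun s => (s + (m : ℂ)) ^ (n + 1) * F s) (𝓝[≠] (-(m : ℂ))) (𝓝 L) ∧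
        ((n + 1 ≤ m * Fintype.card J → (fun y => iteratedDeriv (m * Fintype.card J - (n + 1))
          (fun τ : ℂ => G (-(m : ℂ), τ • y)) 0) ∈ polyFun W (n + 1)) → L ∈ W) := by
  classical
  set k := Fintype.card J with hk
  let den : (Fin n → ℂ) → ℂ := fun u => 1 + ε * ∑ l, u l
  have hden : Differentiable ℂ den := by fun_prop
  let y : Fin (n + 1) → (Fin n → ℂ) → Fin (n + 1) → ℂ := fun i u =>
    i.insertNth (α := fun _ => ℂ) 1 u
  have hy : ∀ i, Differentiable ℂ (y i) := by
    intro i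
    refine differentiable_pi.2 fun l => ?_
    induction l using Fin.succAboveCases i with
    | x => simp only [y, Fin.insertNth_apply_same]; fun_prop
    | p l => simp only [y, Fin.insertNth_apply_succAbove]; fun_prop
  have hyR : ∀ i (u : Fin n → ℝ) (c : ℝ), (c : ℂ) • y i (fun l => (u l : ℂ)) =
      fun l => (((c • i.insertNth (α := fun _ => ℝ) 1 u) l : ℝ) : ℂ) := by
    intro i u c
    ext l
    induction l using Fin.succAboveCases i <;> simp [y]
  let T : (Fin n → ℝ) → ℝ := fun u => (1 + ε * ∑ l, u l)⁻¹
  have hTc : ∀ u : Fin n → ℝ, (den fun l => (u l : ℂ))⁻¹ = T u := by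
    intro u
    simp [den, T]
  have hpos : ∀ u ∈ Set.Icc (0 : Fin n → ℝ) 1, 0 < 1 + ε * ∑ l, u l := fun u hu => by
    have := Finset.sum_nonneg fun l (_ : l ∈ Finset.univ) => hu.1 l
    positivity
  have hT0 : ∀ u ∈ Set.Icc (0 : Fin n → ℝ) 1, 0 < T u := fun u hu => inv_pos.2 (hpos u hu)
  have hT : ∀ i : Fin (n + 1), ∀ u ∈ Set.Icc (0 : Fin n → ℝ) 1, ∀ τ : ℝ, 0 < τ →
      (τ • i.insertNth (α := fun _ => ℝ) 1 u ∈ K ↔ τ ≤ T u) := by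
    intro i u hu τ hτ
    rw [hKT i u hu τ hτ, ← le_div_iff₀ (hpos u hu), one_div]
  let arg : Fin (n + 1) → (ℂ × (Fin n → ℂ)) × ℂ → ℂ × (Fin (n + 1) → ℂ) := fun i z =>
    (z.1.1, ((den z.1.2)⁻¹ * z.2) • y i z.1.2)
  let g : Fin (n + 1) → (ℂ × (Fin n → ℂ)) × ℂ → ℂ := fun i z =>
    (den z.1.2)⁻¹ ^ (k * z.1.1 + n + 1) * G (arg i z)
  let O : Set ((ℂ × (Fin n → ℂ)) × ℂ) := {z | den z.1.2 ∈ slitPlane}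
  have hO : IsOpen O := isOpen_slitPlane.preimage
    (hden.continuous.comp (continuous_snd.comp continuous_fst))
  have hinv : ∀ z ∈ O, DifferentiableAt ℂ
      (fun z : (ℂ × (Fin n → ℂ)) × ℂ => (den z.1.2)⁻¹) z := fun z hz =>
    DifferentiableAt.inv ((hden.comp (differentiable_snd.comp differentiable_fst)) z)
      (slitPlane_ne_zero hz)
  have harg : ∀ i, ∀ z ∈ O, DifferentiableAt ℂ (arg i) z := fun i z hz =>
    DifferentiableAt.prodMk (by fun_prop) (DifferentiableAt.smul
      ((hinv z hz).mul differentiableAt_snd)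
      (((hy i).comp (differentiable_snd.comp differentiable_fst)) z))
  let D' : Fin (n + 1) → Set ((ℂ × (Fin n → ℂ)) × ℂ) := fun i => O ∩ arg i ⁻¹' D
  have hD' : ∀ i, IsOpen (D' i) := fun i =>
    ContinuousOn.isOpen_inter_preimage
      (fun z hz => (harg i z hz).continuousAt.continuousWithinAt) hO hD
  have hg : ∀ i, DifferentiableOn ℂ (g i) (D' i) := by
    intro i z hz
    refine DifferentiableAt.differentiableWithinAt (DifferentiableAt.mul ?_ ?_)
    · exact (hinv z hz.1).cpow (by fun_prop) (inv_mem_slitPlane hz.1)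
    · exact DifferentiableAt.comp z (hG.differentiableAt (hD.mem_nhds hz.2)) (harg i z hz.1)
  have hD'u : ∀ i (s : ℂ), ∀ u ∈ Set.Icc (0 : Fin n → ℝ) 1,
      (s, fun l => (u l : ℂ)) ∈ unitFiberCore (D' i) := by
    intro i s u hu t ht
    have h1 : den (fun l => (u l : ℂ)) = ((1 + ε * ∑ l, u l : ℝ) : ℂ) := by simp [den]
    refine ⟨?_, ?_⟩
    · change den (fun l => (u l : ℂ)) ∈ slitPlane
      rw [h1, ofReal_mem_slitPlane]
      exact hpos u hu
    · change (s, ((den fun l => (u l : ℂ))⁻¹ * (t : ℂ)) • y i fun l => (u l : ℂ)) ∈ D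
      rw [hTc, ← ofReal_mul, hyR]
      refine hDK s _ ?_
      rcases ht.1.eq_or_lt with h | h
      · rwa [← h, mul_zero, zero_smul]
      · refine (hT i u hu _ (mul_pos (hT0 u hu) h)).2 ?_
        exact mul_le_of_le_one_right (hT0 u hu).le ht.2
  choose F hFm hFi L hL hLW using fun i => ih.radial i ha ha0 (hD' i) (hD'u i) (hg i)
  refine ⟨fun s => ∑ i, F i s, fun z => MeromorphicAt.fun_sum fun i _ => hFm i z, fun s hs => ?_,
    ∑ i, L i, ?_, fun hW => W.sum_mem fun i _ => hLW i fun hmk => ?_⟩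
  · have hcont : ContinuousOn (fun t : Fin (n + 1) → ℝ =>
        (∏ j, ((∑ l, (a j l : ℝ) * t l : ℝ) : ℂ) ^ s) * G (s, fun l => (t l : ℂ))) K := by
      refine ContinuousOn.mul (Continuous.continuousOn ?_) ?_
      · refine continuous_finsetProd _ fun j _ => ?_
        exact (continuous_ofReal_cpow_const hs).comp (by fun_prop)
      · exact hG.continuousOn.comp (by fun_prop) fun t ht => hDK s t ht
    obtain ⟨C, hC⟩ := (isCompact_Icc.of_isClosed_subset hK hK01).exists_bound_of_continuousOn hcont
    rw [setIntegral_eq_sum_cone hK.measurableSet hK01 hT0 hT ?_ hC]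
    · refine Finset.sum_congr rfl fun i _ => ?_
      rw [hFi i s hs]
      refine setIntegral_congr_fun measurableSet_Icc fun u hu => ?_
      refine intervalIntegral.integral_congr_ae (ae_of_all _ fun w hw => ?_)
      rw [Set.uIoc_of_le zero_le_one] at hw
      have h4 : ∀ j, ∑ l, (a j l : ℝ) * ((w * T u) • i.insertNth (α := fun _ => ℝ) 1 u) l =
          T u * ∑ l, (a j l : ℝ) * (w • i.insertNth (α := fun _ => ℝ) 1 u) l := by
        intro j
        rw [Finset.mul_sum]
        exact Finset.sum_congr rfl fun l _ => by simp; ring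
      have h5 : ∀ j, 0 ≤ ∑ l, (a j l : ℝ) * (w • i.insertNth (α := fun _ => ℝ) 1 u) l := by
        intro j
        refine Finset.sum_nonneg fun l _ => mul_nonneg (by exact_mod_cast ha j l) ?_
        induction l using Fin.succAboveCases i with
        | x => simpa using hw.1.le
        | p l => simpa using mul_nonneg hw.1.le (hu.1 l)
      simp only [g, arg, hTc]
      rw [← ofReal_mul, hyR, mul_comm (T u) w]
      simp only [h4]
      rw [cpow_nonneg_form (hT0 u hu) h5, ← hk, add_assoc, ← Nat.cast_succ,
        cpow_add _ _ (by exact_mod_cast (hT0 u hu).ne'), cpow_natCast, Nat.succ_eq_add_one]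
      ring
    · rw [← Set.piecewise_eq_indicator]
      exact hcont.measurable_piecewise continuousOn_const hK.measurableSet
  · simp only [Finset.mul_sum]
    exact tendsto_finsetSum _ fun i _ => hL i
  · refine ⟨_, comp_mem_polyFun (φ := fun l u => y i u l) (hW hmk) fun l => ?_, ?_⟩
    · induction l using Fin.succAboveCases i with
      | x => simpa [y] using const_mem_polyFun (n := n) (ratCast_mem_one 1)
      | p l => simpa [y] using proj_mem_polyFun l
    · have h0 : ∀ᶠ u in 𝓝 (0 : Fin n → ℂ), den u ≠ 0 :=
        hden.continuous.continuousAt.eventually_ne (by simp [den])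
      filter_upwards [h0] with u hu
      set e := m * k - (n + 1) with he
      have h1 : (k * -(m : ℂ) + n + 1 : ℂ) = -e := by
        have : m * k = e + (n + 1) := (Nat.sub_add_cancel hmk).symm
        have : (m * k : ℂ) = e + (n + 1) := by exact_mod_cast this
        linear_combination -this
      simp only [g, arg, h1]
      rw [iteratedDeriv_const_mul_field]
      have := congrFun (iteratedDeriv_comp_const_mul_field e
        (fun τ => G (-(m : ℂ), τ • y i u)) (den u)⁻¹) 0
      simp only [mul_zero] at this
      rw [this, cpow_neg, cpow_natCast, inv_mul_cancel_left₀ (pow_ne_zero _ (inv_ne_zero hu))]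

end star

theorem apply_mem_of_mem_polyFun_zero {W : Submodule ℚ ℂ} {f : (Fin 0 → ℂ) → ℂ}
    (hf : f ∈ polyFun W 0) (y : Fin 0 → ℂ) : f y ∈ W := by
  induction hf using Submodule.span_induction with
  | mem f hf =>
    obtain ⟨w, hw, α, rfl⟩ := hf
    simpa using hw
  | zero => exact W.zero_mem
  | add a b _ _ ha hb => exact W.add_mem ha hb
  | smul r a _ ha => exact W.smul_mem r ha

theorem cubeContinuation_zero (m : ℕ) (W : Submodule ℚ ℂ) : CubeContinuation m W 0 := by
  intro J _ a _ ha0 D G hD hDu hG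
  have hJ : IsEmpty J := ⟨fun j => ha0 j (Subsingleton.elim _ _)⟩
  have hmem : ∀ s : ℂ, (s, (0 : Fin 0 → ℂ)) ∈ D := fun s => by
    have := hDu s 0 ⟨le_rfl, zero_le_one⟩
    rwa [Subsingleton.elim (fun i : Fin 0 => (((0 : Fin 0 → ℝ) i : ℝ) : ℂ)) 0] at this
  have hd : Differentiable ℂ fun s : ℂ => G (s, (0 : Fin 0 → ℂ)) := fun s =>
    DifferentiableAt.comp (f := fun s : ℂ => (s, (0 : Fin 0 → ℂ))) s
      (hG.differentiableAt (hD.mem_nhds (hmem s))) (by fun_prop)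
  refine ⟨fun s => G (s, 0), fun z => (hd.analyticAt z).meromorphicAt, fun s _ => ?_,
    G (-(m : ℂ), 0), ?_, fun h => ?_⟩
  · have h1 : Set.Icc (0 : Fin 0 → ℝ) 1 = Set.univ := by
      ext u
      simp [Subsingleton.elim u 0]
    rw [h1, setIntegral_univ, volume_pi, Measure.pi_of_empty _ 0, integral_dirac]
    simp only [Finset.univ_eq_empty, Finset.prod_empty, one_mul]
    rw [Subsingleton.elim (fun i : Fin 0 => (((0 : Fin 0 → ℝ) i : ℝ) : ℂ)) 0]
  · simpa using (hd.continuous.continuousAt (x := -(m : ℂ))).tendsto.mono_left nhdsWithin_le_nhds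
  · simpa using apply_mem_of_mem_polyFun_zero (h 0) 0

theorem cubeContinuation (m : ℕ) (W : Submodule ℚ ℂ) (n : ℕ) : CubeContinuation m W n := by
  induction n with
  | zero => exact cubeContinuation_zero m W
  | succ n ih =>
    intro J _ a ha ha0 D G hD hDu hG
    obtain ⟨F, hFm, hFi, L, hL, hLW⟩ := ih.star ha ha0 (K := Set.Icc 0 1) isClosed_Icc le_rfl
      ⟨le_rfl, zero_le_one⟩ le_rfl (fun i u hu τ hτ => by
        rw [zero_mul, add_zero, mul_one]
        constructor
        · intro h
          simpa using h.2 i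
        · intro h
          refine ⟨fun l => ?_, fun l => ?_⟩ <;> induction l using Fin.succAboveCases i with
          | x => simpa using by linarith
          | p l =>
            have h0 := hu.1 l
            have h1 := hu.2 l
            simp only [Pi.zero_apply, Pi.one_apply] at h0 h1
            simp only [Pi.zero_apply, Pi.one_apply, Pi.smul_apply, Fin.insertNth_apply_succAbove,
              smul_eq_mul]
            first | positivity | exact mul_le_one₀ h h0 h1) hD hDu hG
    exact ⟨F, hFm, hFi, L, hL, fun hT => hLW fun _ => hT _⟩

theorem iteratedDeriv_eq_of_eventually_hasSum {φ : ℂ → ℂ} {S : ℕ → ℂ}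
    (h : ∀ᶠ τ in 𝓝 (0 : ℂ), HasSum (fun d => τ ^ d * S d) (φ τ)) (d : ℕ) :
    iteratedDeriv d φ 0 = d.factorial * S d := by
  have h1 : HasFPowerSeriesAt φ (FormalMultilinearSeries.ofScalars ℂ S) 0 := by
    rw [hasFPowerSeriesAt_iff]
    simpa using h
  have h2 := h1.eq_formalMultilinearSeries h1.analyticAt.hasFPowerSeriesAt
  have h3 := congrArg (fun p => p.coeff d) h2
  simp only [FormalMultilinearSeries.coeff_ofScalars] at h3
  rw [h3, mul_div_cancel₀ _ (Nat.cast_ne_zero.2 d.factorial_ne_zero)]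

theorem iteratedDeriv_ray_mem_polyFun_of_hasSum {n : ℕ} {W : Submodule ℚ ℂ}
    {f : (Fin n → ℂ) → ℂ} {p : Fin n → ℂ} {c : (Fin n →₀ ℕ) → ℂ} {r : ℝ} (hr : 0 < r)
    (hf : ∀ z : Fin n → ℂ, (∀ i, ‖z i - p i‖ < r) →
      HasSum (fun α : Fin n →₀ ℕ => c α * ∏ i, (z i - p i) ^ α i) (f z))
    {d : ℕ} (hc : ∀ α : Fin n →₀ ℕ, ∑ i, α i = d → c α ∈ W) :
    (fun z => iteratedDeriv d (fun τ : ℂ => f (p + τ • z)) 0) ∈ polyFun W n := by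
  have key : ∀ z, iteratedDeriv d (fun τ : ℂ => f (p + τ • z)) 0 =
      ∑ α ∈ Finset.finsuppAntidiag Finset.univ d, (d.factorial : ℂ) * (c α * ∏ i, z i ^ α i) := by
    intro z
    rw [← Finset.mul_sum]
    refine iteratedDeriv_eq_of_eventually_hasSum (S := fun d =>
      ∑ α ∈ Finset.finsuppAntidiag Finset.univ d, c α * ∏ i, z i ^ α i) ?_ d
    have hsmall : ∀ᶠ τ in 𝓝 (0 : ℂ), ∀ i, ‖τ * z i‖ < r := by
      refine eventually_all.2 fun i => ?_
      have hcont : Continuous fun τ : ℂ => ‖τ * z i‖ := by fun_prop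
      exact hcont.continuousAt.eventually_lt continuousAt_const (by simpa using hr)
    filter_upwards [hsmall] with τ hτ
    have h1 := (hf (p + τ • z) (by simpa using hτ)).tsum_fiberwise (fun α => ∑ i, α i)
    refine h1.congr_fun fun d => ?_
    have hset : (fun α : Fin n →₀ ℕ => ∑ i, α i) ⁻¹' {d} =
        ((Finset.finsuppAntidiag Finset.univ d : Finset (Fin n →₀ ℕ)) : Set (Fin n →₀ ℕ)) := by
      ext α
      simp
    rw [hset, Finset.tsum_subtype' (Finset.finsuppAntidiag Finset.univ d)
      (fun α : Fin n →₀ ℕ => c α * ∏ i, ((p + τ • z) i - p i) ^ α i), Finset.mul_sum]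
    refine Finset.sum_congr rfl fun α hα => ?_
    have hd : ∑ i, α i = d := by simpa using hα
    simp only [Pi.add_apply, add_sub_cancel_left, Pi.smul_apply, smul_eq_mul, mul_pow,
      Finset.prod_mul_distrib, Finset.prod_pow_eq_pow_sum, hd]
    ring
  simp only [key]
  refine sum_mem_polyFun _ fun α hα => ?_
  have hd : ∑ i, α i = d := by simpa using hα
  have := mul_mem_polyFun (const_mem_polyFun (n := n) (ratCast_mem_one d.factorial))
    (monomial_mem_polyFun (hc α hd) α)
  simpa using this

/-- The convex hull of a finite family is the image, under the affine chart based at one of the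
points, of the corner simplex. -/
theorem convexHull_range_eq_image_corner {F : Type*} [AddCommGroup F] [Module ℝ F] {n : ℕ}
    (v : Fin (n + 1) → F) (l : Fin (n + 1)) :
    convexHull ℝ (Set.range v) =
      (fun t : Fin n → ℝ => v l + ∑ i, t i • (v (l.succAbove i) - v l)) ''
        {t | (∀ i, 0 ≤ t i) ∧ ∑ i, t i ≤ 1} := by
  have himg : convexHull ℝ (Set.range v) =
      Fintype.linearCombination ℝ v '' stdSimplex ℝ (Fin (n + 1)) := by
    rw [← convexHull_basis_eq_stdSimplex, LinearMap.image_convexHull, ← Set.range_comp]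
    congr 2
    ext i
    simp [Fintype.linearCombination_apply]
  rw [himg]
  ext x
  constructor
  · rintro ⟨w, ⟨hw0, hw1⟩, rfl⟩
    rw [Fin.sum_univ_succAbove _ l] at hw1
    refine ⟨fun i => w (l.succAbove i), ⟨fun i => hw0 _, by linarith [hw0 l]⟩, ?_⟩
    have hl : w l = 1 - ∑ i, w (l.succAbove i) := by linarith
    simp only [Fintype.linearCombination_apply, Fin.sum_univ_succAbove _ l, smul_sub,
      Finset.sum_sub_distrib, ← Finset.sum_smul, hl, sub_smul, one_smul]
    abel
  · rintro ⟨t, ⟨ht0, ht1⟩, rfl⟩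
    refine ⟨l.insertNth (α := fun _ => ℝ) (1 - ∑ i, t i) t, ⟨?_, ?_⟩, ?_⟩
    · rw [Fin.forall_iff_succAbove l]
      simpa using ⟨ht1, ht0⟩
    · simp [Fin.sum_univ_succAbove _ l]
    · simp only [Fintype.linearCombination_apply, Fin.sum_univ_succAbove _ l, smul_sub,
        Finset.sum_sub_distrib, ← Finset.sum_smul, Fin.insertNth_apply_same,
        Fin.insertNth_apply_succAbove, sub_smul, one_smul]
      abel

/-- Change of variables from a simplex to the corner simplex. -/
theorem setIntegral_image_add_linearMap {n : ℕ} (p : Fin n → ℝ)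
    (T : (Fin n → ℝ) →L[ℝ] (Fin n → ℝ)) (hT : Function.Injective T) {K : Set (Fin n → ℝ)}
    (hK : MeasurableSet K) (g : (Fin n → ℝ) → ℂ) :
    ∫ x in (fun t => p + T t) '' K, g x = ((|T.det| : ℝ) : ℂ) * ∫ t in K, g (p + T t) := by
  rw [integral_image_eq_integral_abs_det_fderiv_smul (f' := fun _ => T) volume hK
    (fun x _ => (T.hasFDerivAt.const_add p).hasFDerivWithinAt)
    (fun x _ y _ h => hT (add_left_cancel h)), ← integral_const_mul]
  simp [Complex.real_smul]

theorem ofReal_prod_cpow {ι : Type*} (s : Finset ι) {a : ι → ℝ} (ha : ∀ i ∈ s, 0 ≤ a i) (z : ℂ) :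
    ((∏ i ∈ s, a i : ℝ) : ℂ) ^ z = ∏ i ∈ s, (a i : ℂ) ^ z := by
  classical
  induction s using Finset.induction_on with
  | empty => simp
  | insert i s hi ih =>
    rw [Finset.prod_insert hi, Finset.prod_insert hi, Complex.ofReal_mul,
      Complex.mul_cpow_ofReal_nonneg (ha i (Finset.mem_insert_self i s))
        (Finset.prod_nonneg fun j hj => ha j (Finset.mem_insert_of_mem hj)),
      ih fun j hj => ha j (Finset.mem_insert_of_mem hj)]

/-- A linear map sending the standard basis to rational vectors has rational determinant. -/
theorem exists_ratCast_eq_abs_det {n : ℕ} (T : (Fin n → ℝ) →L[ℝ] (Fin n → ℝ))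
    {e : Fin n → Fin n → ℚ} (hT : ∀ t r, T t r = ∑ i, t i * e i r) :
    ∃ q : ℚ, |T.det| = q := by
  have hM : LinearMap.toMatrix' (T : (Fin n → ℝ) →ₗ[ℝ] (Fin n → ℝ)) =
      (Matrix.of fun r i => e i r).map (Rat.castHom ℝ) := by
    ext r i
    simp [LinearMap.toMatrix'_apply, hT, Pi.single_apply]
  refine ⟨|(Matrix.of fun r i => e i r).det|, ?_⟩
  have hdet := RingHom.map_det (Rat.castHom ℝ) (Matrix.of fun r i => e i r)
  rw [RingHom.mapMatrix_apply] at hdet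
  rw [ContinuousLinearMap.det, ← LinearMap.det_toMatrix', hM, ← hdet]
  simp

/-- If all the affine forms `f₁,…,f_k` vanish at a common vertex `p` of `V`
and `E(-m, ·)` is `𝔙`-defined at `p` (its Taylor coefficient of total degree `d` at `p` lies in
`𝒱 d` for each `d`), then the leading Laurent coefficient `lim (s+m)^n F(s)` of the continuation
of `∫_V (f₁⋯f_k)^s E(s,x) dx` at `s = -m` lies in `𝒱 (m·k - n)`. -/
theorem stmt_12 (n k : ℕ) (hn : 1 ≤ n) (m : ℕ) (hm : 0 < m) (hmk : n ≤ m * k)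
    (V : Set (Fin n → ℝ)) (v : Fin (n + 1) → (Fin n → ℝ))
    (hv : AffineIndependent ℝ v) (hV : V = convexHull ℝ (Set.range v))
    (hvQ : ∀ l i, ∃ q : ℚ, v l i = (q : ℝ))
    (f : Fin k → (Fin n → ℝ) → ℝ)
    (hf_aff : ∀ j, ∃ (a : Fin n → ℚ) (c : ℚ),
      f j = fun x => (c : ℝ) + ∑ i, (a i : ℝ) * x i)
    (hf_pos : ∀ j, ∀ x ∈ interior V, 0 < f j x)
    (p : Fin n → ℝ) (hp : p ∈ Set.range v) (hfp : ∀ j, f j p = 0)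
    (E : ℂ × (Fin n → ℂ) → ℂ)
    (U : Set (ℂ × (Fin n → ℂ))) (hU : IsOpen U)
    (hUV : ∀ (s : ℂ) (x : Fin n → ℝ), x ∈ V → (s, fun i => (x i : ℂ)) ∈ U)
    (hE : AnalyticOnNhd ℂ E U)
    (𝒱 : ℕ → Submodule ℚ ℂ)
    -- the Taylor expansion of `E(-m, ·)` at `p`, with coefficient of `(x-p)^α` in `𝒱 |α|`:
    (c : (Fin n →₀ ℕ) → ℂ) (r : ℝ) (hr : 0 < r)
    (hc : ∀ α : Fin n →₀ ℕ, c α ∈ 𝒱 (∑ i, α i))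
    (hTaylor : ∀ z : Fin n → ℂ, (∀ i, ‖z i - (p i : ℂ)‖ < r) →
      HasSum (fun α : Fin n →₀ ℕ => c α * ∏ i, (z i - (p i : ℂ)) ^ α i) (E (-(m : ℂ), z))) :
    ∃ F : ℂ → ℂ,
      (∀ z : ℂ, MeromorphicAt F z) ∧
      (∀ s : ℂ, 0 < s.re →
        F s = ∫ x in V, (↑(∏ j, f j x) : ℂ) ^ s * E (s, fun i => (x i : ℂ))) ∧
      ∃ L ∈ 𝒱 (m * k - n), Tendsto (fun s => (s + (m : ℂ)) ^ n * F s)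
        (nhdsWithin (-(m : ℂ)) {-(m : ℂ)}ᶜ) (nhds L) := by
  obtain ⟨n, rfl⟩ : ∃ n', n = n' + 1 := ⟨n - 1, by omega⟩
  obtain ⟨l₀, rfl⟩ := hp
  choose vQ hvQ using hvQ
  choose A b hf_aff using hf_aff
  set eQ : Fin (n + 1) → Fin (n + 1) → ℚ := fun i r => vQ (l₀.succAbove i) r - vQ l₀ r with heQ
  set T : (Fin (n + 1) → ℝ) →L[ℝ] (Fin (n + 1) → ℝ) := LinearMap.toContinuousLinearMap
    (Fintype.linearCombination ℝ fun i => v (l₀.succAbove i) - v l₀) with hT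
  have hTapp : ∀ t, T t = ∑ i, t i • (v (l₀.succAbove i) - v l₀) := fun t => by
    simp [hT, Fintype.linearCombination_apply]
  have hTr : ∀ t r, T t r = ∑ i, t i * eQ i r := fun t r => by
    simp [hTapp, Finset.sum_apply, hvQ, heQ]
  have hTinj : Function.Injective T := by
    have h1 := ((affineIndependent_iff_linearIndependent_vsub ℝ v l₀).1 hv).comp
      (fun i : Fin (n + 1) => (⟨l₀.succAbove i, l₀.succAbove_ne i⟩ : {x // x ≠ l₀}))
      (fun i j hij => Fin.succAbove_right_injective (Subtype.ext_iff.1 hij))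
    exact linearIndependent_iff_injective_fintypeLinearCombination.1 h1
  set K : Set (Fin (n + 1) → ℝ) := {t | (∀ i, 0 ≤ t i) ∧ ∑ i, t i ≤ 1} with hKdef
  have hKclosed : IsClosed K := by
    have h1 : K = (⋂ i, {t | 0 ≤ t i}) ∩ {t | ∑ i, t i ≤ 1} := by
      ext t; simp [hKdef]
    rw [h1]
    exact (isClosed_iInter fun i => isClosed_le continuous_const (continuous_apply i)).inter
      (isClosed_le (by fun_prop) continuous_const)
  have hVK : V = (fun t => v l₀ + T t) '' K := by
    rw [hV, convexHull_range_eq_image_corner v l₀]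
    simp only [hTapp, hKdef]
  have hmemV : ∀ t ∈ K, v l₀ + T t ∈ V := fun t ht => hVK ▸ ⟨t, ht, rfl⟩
  have hint : (interior V).Nonempty := by
    rw [hV, interior_convexHull_nonempty_iff_affineSpan_eq_top,
      hv.affineSpan_eq_top_iff_card_eq_finrank_add_one]
    simp
  have hf_nonneg : ∀ j, ∀ x ∈ V, 0 ≤ f j x := by
    intro j x hx
    have hcl : IsClosed {y | 0 ≤ f j y} := by
      rw [hf_aff]
      exact isClosed_le continuous_const (by fun_prop)
    have hconv : Convex ℝ V := hV ▸ convex_convexHull ℝ _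
    have h1 : closure (interior V) ⊆ {y | 0 ≤ f j y} :=
      closure_minimal (fun y hy => (hf_pos j y hy).le) hcl
    rw [hconv.closure_interior_eq_closure_of_nonempty_interior hint] at h1
    exact h1 (subset_closure hx)
  set a : Fin k → Fin (n + 1) → ℚ := fun j i => ∑ r, A j r * eQ i r with ha_def
  have hfT : ∀ j t, f j (v l₀ + T t) = ∑ i, (a j i : ℝ) * t i := by
    intro j t
    have h0 := hfp j
    rw [hf_aff] at h0 ⊢
    simp only [Pi.add_apply, mul_add, Finset.sum_add_distrib, hTr, ← add_assoc] at h0 ⊢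
    rw [h0, zero_add]
    simp only [ha_def, Rat.cast_sum, Rat.cast_mul, Finset.mul_sum, Finset.sum_mul]
    rw [Finset.sum_comm]
    refine Finset.sum_congr rfl fun i _ => Finset.sum_congr rfl fun r _ => ?_
    ring
  have ha_nonneg : ∀ j i, 0 ≤ a j i := by
    intro j i
    have hmem : (Pi.single i 1 : Fin (n + 1) → ℝ) ∈ K := by
      refine ⟨fun l => ?_, by simp⟩
      rw [Pi.single_apply]
      split_ifs <;> norm_num
    have h1 := hf_nonneg j _ (hmemV _ hmem)
    rw [hfT] at h1
    simpa [Pi.single_apply] using h1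
  have ha_ne : ∀ j, a j ≠ 0 := by
    intro j hj
    obtain ⟨x, hx⟩ := hint
    have h1 := hf_pos j x hx
    obtain ⟨t, -, rfl⟩ := hVK ▸ interior_subset hx
    simp [hfT, hj] at h1
  set χ : (Fin (n + 1) → ℂ) → Fin (n + 1) → ℂ := fun y r => ∑ i, y i * (eQ i r : ℂ) with hχ
  have hχ_real : ∀ t : Fin (n + 1) → ℝ,
      ((fun i => (v l₀ i : ℂ)) + χ fun i => (t i : ℂ)) = fun i => ((v l₀ + T t) i : ℂ) := by
    intro t
    ext r
    simp [hχ, hTr]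
  have hχ_smul : ∀ (τ : ℂ) y, χ (τ • y) = τ • χ y := by
    intro τ y
    ext r
    simp [hχ, Finset.mul_sum, mul_assoc]
  set ψ : ℂ × (Fin (n + 1) → ℂ) → ℂ × (Fin (n + 1) → ℂ) :=
    fun q => (q.1, (fun i => (v l₀ i : ℂ)) + χ q.2) with hψ
  have hψ_diff : Differentiable ℂ ψ := by
    simp only [hψ, hχ]
    fun_prop
  obtain ⟨q, hq⟩ := exists_ratCast_eq_abs_det T hTr
  obtain ⟨F, hFm, hFint, L, hL, hLmem⟩ := (cubeContinuation m (𝒱 (m * k - (n + 1))) n).star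
    ha_nonneg ha_ne hKclosed
    (fun t ht => ⟨ht.1, fun i =>
      (Finset.single_le_sum (fun l _ => ht.1 l) (Finset.mem_univ i)).trans ht.2⟩)
    (by simp [hKdef]) zero_le_one
    (fun i u hu τ hτ => by
      have hnn : ∀ l, 0 ≤ (τ • i.insertNth (α := fun _ => ℝ) 1 u) l := by
        rw [Fin.forall_iff_succAbove i]
        simpa using ⟨hτ.le, fun l => mul_nonneg hτ.le (hu.1 l)⟩
      have hsum : ∑ l, (τ • i.insertNth (α := fun _ => ℝ) 1 u) l = τ * (1 + 1 * ∑ l, u l) := by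
        simp [Fin.sum_univ_succAbove _ i, mul_add, Finset.mul_sum]
      rw [← hsum]
      exact ⟨fun h => h.2, fun h => ⟨hnn, h⟩⟩)
    (hU.preimage hψ_diff.continuous) (G := fun q => E (ψ q))
    (fun s t ht => by
      have := hUV s _ (hmemV t ht)
      rwa [← hχ_real] at this)
    (hE.differentiableOn.comp hψ_diff.differentiableOn fun _ h => h)
  refine ⟨fun s => (q : ℂ) * F s, fun z => (MeromorphicAt.const _ z).mul (hFm z), fun s hs => ?_,
    (q : ℂ) * L, ratCast_mul_mem q (hLmem fun _ => ?_), ?_⟩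
  · beta_reduce
    rw [hVK, setIntegral_image_add_linearMap _ _ hTinj hKclosed.measurableSet, hFint s hs, hq,
      Complex.ofReal_ratCast]
    congr 1
    refine setIntegral_congr_fun hKclosed.measurableSet fun t ht => ?_
    simp only [hψ, hχ_real, ← hfT]
    rw [ofReal_prod_cpow _ fun j _ => hf_nonneg j _ (hmemV t ht)]
  · rw [Fintype.card_fin]
    have hpoly := iteratedDeriv_ray_mem_polyFun_of_hasSum (W := 𝒱 (m * k - (n + 1))) hr hTaylor
      (d := m * k - (n + 1)) fun α hα => hα ▸ hc α
    have h1 := comp_mem_polyFun hpoly (φ := fun r y => χ y r) fun r =>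
      sum_mem_polyFun _ fun i _ =>
        mul_mem_polyFun (proj_mem_polyFun i) (const_mem_polyFun (ratCast_mem_one _))
    simpa only [hψ, hχ_smul] using h1
  · simpa only [mul_left_comm] using hL.const_mul (q : ℂ)
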